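/- For every δ > 0 there exists a first-order sentence φ in the language L_1 (one binary relation symbol and one unary relation symbol) such that for every α with 0 < α < 1/2 − δ, the sequence n ↦ P(G(n, n^{−α}) EMSO-satisfies φ) does not converge as n → ∞. -/

import Mathlib

open Filter FirstOrder

noncomputable section

/-! ### The binomial random graph `G(n,p)` -/

/-- The number of edges of a simple graph. -/
noncomputable def edgeCt {n : ℕ} (G : SimpleGraph (Fin n)) : ℕ := Nat.card G.edgeSet

open scoped Classical in
/-- `prob n p Q` is the probability that the binomial random graph `G(n,p)` (on vertex set
`Fin n`) has property `Q`: the sum over all graphs `G` with `Q G` of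
`p^{e(G)} (1-p)^{n(n-1)/2 - e(G)}`. -/
noncomputable def prob (n : ℕ) (p : ℝ) (Q : SimpleGraph (Fin n) → Prop) : ℝ :=
  ∑ G : SimpleGraph (Fin n),
    if Q G then p ^ edgeCt G * (1 - p) ^ (n * (n - 1) / 2 - edgeCt G) else 0

/-- `expec n p W` is the expectation of a real-valued function `W` of the binomial random
graph `G(n,p)`. -/
noncomputable def expec (n : ℕ) (p : ℝ) (W : SimpleGraph (Fin n) → ℝ) : ℝ :=
  ∑ G : SimpleGraph (Fin n),
    W G * (p ^ edgeCt G * (1 - p) ^ (n * (n - 1) / 2 - edgeCt G))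

/-! ### The graphs `W_a^γ` and `W_a^{γ,*}` -/

/-- `ωr r a = (r^a − 1)/(r−1)`, the number of vertices of the perfect `r`-ary tree of
depth `a − 1`. -/
def ωr (r a : ℕ) : ℕ := (r ^ a - 1) / (r - 1)

/-- The depth of the node with (0-based) breadth-first (heap) index `j` in the infinite
`r`-ary tree: the root has index 0, and the parent of node `j ≥ 1` is node `(j−1)/r`. -/
def heapDepth (r : ℕ) : ℕ → ℕ
  | 0 => 0
  | j + 1 => heapDepth r (j / r) + 1
  decreasing_by exact Nat.lt_succ_of_le (Nat.div_le_self _ _)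

/-- The vertex set of `W_a^γ`: the path `F₁` on `a` vertices (`Sum.inl`), together with,
for each of the `(4^a−1)/3` vertices `i` of the perfect 4-ary tree `F₂` (in breadth-first
order), the vertex `(i,0)` of `F₂` itself and the `γ` inner vertices `(i,1),…,(i,γ)` of the
path `P_{γ+2}` joining `i` to the vertex of `F₁` at the same distance from the root. -/
abbrev WVert (γ a : ℕ) := Fin a ⊕ (Fin (ωr 4 a) × Fin (γ + 1))

/-- Base (directed) adjacency relation generating `W_a^γ`: consecutive `F₁`-vertices;
the last inner path vertex `(i,γ)` is joined to the `F₁`-vertex at depth of `i`;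
consecutive vertices along each `P_{γ+2}`; and tree edges of the perfect 4-ary tree
(in heap indexing, `j` is the parent of `i ≥ 1` iff `j = (i−1)/4`). -/
def Wbase (γ a : ℕ) : WVert γ a → WVert γ a → Prop
  | Sum.inl u, Sum.inl v => (v : ℕ) = (u : ℕ) + 1
  | Sum.inl u, Sum.inr iv => (iv.2 : ℕ) = γ ∧ heapDepth 4 (iv.1 : ℕ) = (u : ℕ)
  | Sum.inr _, Sum.inl _ => False
  | Sum.inr iv, Sum.inr jw =>
      (iv.1 = jw.1 ∧ (jw.2 : ℕ) = (iv.2 : ℕ) + 1) ∨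
      ((iv.2 : ℕ) = 0 ∧ (jw.2 : ℕ) = 0 ∧ 1 ≤ (iv.1 : ℕ) ∧ (jw.1 : ℕ) = ((iv.1 : ℕ) - 1) / 4)

/-- The graph `W_a^γ`. -/
def WG (γ a : ℕ) : SimpleGraph (WVert γ a) := SimpleGraph.fromRel (Wbase γ a)

/-- The vertex set of `W_a^{γ,*}` (with `ω₁ = ωr r a`, `ω₂ = ωr r ω₁`), as five pieces:
the path `F₁` on `a` vertices; the tree `F₂` together with the inner vertices of the
paths `P_{γ+2}` joining `F₂` to `F₁` (pairs `(i,k)`, `k = 0` being the `F₂`-vertex itself);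
the `γ` inner vertices of the paths `P_{γ+2}` joining the `i`-th vertex of `F₂` (in
breadth-first order) to the `i`-th vertex of the path `F̃₁`; the path `F̃₁` on `ω₁`
vertices; and the tree `F̃₂` together with the inner vertices of the paths `P_{γ+2}`
joining `F̃₂` to `F̃₁`. -/
abbrev WSVert (γ r a : ℕ) :=
  Fin a ⊕ ((Fin (ωr r a) × Fin (γ + 1)) ⊕ ((Fin (ωr r a) × Fin γ) ⊕
    (Fin (ωr r a) ⊕ (Fin (ωr r (ωr r a)) × Fin (γ + 1)))))

/-- Base (directed) adjacency relation generating `W_a^{γ,*}`. -/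
def WSbase (γ r a : ℕ) : WSVert γ r a → WSVert γ r a → Prop
  | .inl u, .inl v => (v : ℕ) = (u : ℕ) + 1
  | .inl u, .inr (.inl iv) => (iv.2 : ℕ) = γ ∧ heapDepth r (iv.1 : ℕ) = (u : ℕ)
  | .inr (.inl iv), .inr (.inl jw) =>
      (iv.1 = jw.1 ∧ (jw.2 : ℕ) = (iv.2 : ℕ) + 1) ∨
      ((iv.2 : ℕ) = 0 ∧ (jw.2 : ℕ) = 0 ∧ 1 ≤ (iv.1 : ℕ) ∧ (jw.1 : ℕ) = ((iv.1 : ℕ) - 1) / r)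
  | .inr (.inl iv), .inr (.inr (.inl jm)) => (iv.2 : ℕ) = 0 ∧ iv.1 = jm.1 ∧ (jm.2 : ℕ) = 0
  | .inr (.inl iv), .inr (.inr (.inr (.inl d))) => γ = 0 ∧ (iv.2 : ℕ) = 0 ∧ (iv.1 : ℕ) = (d : ℕ)
  | .inr (.inr (.inl im)), .inr (.inr (.inl jm)) => im.1 = jm.1 ∧ (jm.2 : ℕ) = (im.2 : ℕ) + 1
  | .inr (.inr (.inl im)), .inr (.inr (.inr (.inl d))) =>
      (im.2 : ℕ) + 1 = γ ∧ (im.1 : ℕ) = (d : ℕ)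
  | .inr (.inr (.inr (.inl d))), .inr (.inr (.inr (.inl e))) => (e : ℕ) = (d : ℕ) + 1
  | .inr (.inr (.inr (.inl d))), .inr (.inr (.inr (.inr jw))) =>
      (jw.2 : ℕ) = γ ∧ heapDepth r (jw.1 : ℕ) = (d : ℕ)
  | .inr (.inr (.inr (.inr iv))), .inr (.inr (.inr (.inr jw))) =>
      (iv.1 = jw.1 ∧ (jw.2 : ℕ) = (iv.2 : ℕ) + 1) ∨
      ((iv.2 : ℕ) = 0 ∧ (jw.2 : ℕ) = 0 ∧ 1 ≤ (iv.1 : ℕ) ∧ (jw.1 : ℕ) = ((iv.1 : ℕ) - 1) / r)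
  | _, _ => False

/-- The graph `W_a^{γ,*}`. -/
def WSG (γ r a : ℕ) : SimpleGraph (WSVert γ r a) := SimpleGraph.fromRel (WSbase γ r a)

/-- `Vnum γ r a = V_{γ,r}(a) = a + 2(γ+1)ω_r(a) + (γ+1)ω_r(ω_r(a))`,
the number of vertices of `W_a^{γ,*}`. -/
def Vnum (γ r a : ℕ) : ℕ := a + 2 * (γ + 1) * ωr r a + (γ + 1) * ωr r (ωr r a)

/-- `s` is (the vertex set of) an induced copy of `H` in `G`. -/
def IsInducedCopy {V W : Type} (H : SimpleGraph W) (G : SimpleGraph V) (s : Set V) : Prop :=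
  Nonempty (H ≃g G.induce s)

/-! ### The quantities `k_γ` and `f` -/

/-- `kcoef α γ = k_γ = 2(1 − α(γ+2)/(γ+1))`. -/
def kcoef (α : ℝ) (γ : ℕ) : ℝ := 2 * (1 - α * ((γ : ℝ) + 2) / ((γ : ℝ) + 1))

/-- `ff α x = f(x) = x^α · ln x`. -/
def ff (α x : ℝ) : ℝ := x ^ α * Real.log x

/-! ### The language `L_m` and EMSO satisfaction -/

/-- Relation symbols of the language `L_m`: `m` unary symbols and one binary symbol. -/
def LRel (m : ℕ) : ℕ → Type
  | 1 => Fin m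
  | 2 => Unit
  | _ => Empty

/-- The first-order language `L_m`: one binary relation symbol, `m` unary relation symbols
and no function symbols. -/
def Lang (m : ℕ) : Language where
  Functions := fun _ => Empty
  Relations := LRel m

/-- The `L_m`-structure on `Fin n` whose binary relation is adjacency in the graph `G` and
whose `i`-th unary relation is membership in `S i`. -/
def structOf {n m : ℕ} (G : SimpleGraph (Fin n)) (S : Fin m → Set (Fin n)) :
    (Lang m).Structure (Fin n) where
  funMap := fun f _ => Empty.elim f
  RelMap := fun {k} r v =>
    match k, r, v with
    | 1, i, v => v 0 ∈ S i
    | 2, _, v => G.Adj (v 0) (v 1)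
    | 0, r, _ => Empty.elim r
    | (_ + 3), r, _ => Empty.elim r

/-- `G` EMSO-satisfies the `L_m`-sentence `φ`: there are sets `S 0, …, S (m-1)` of vertices
such that the structure on `Fin n` given by adjacency in `G` and membership in the `S i`
satisfies `φ`. -/
def EMSOSat {n m : ℕ} (G : SimpleGraph (Fin n)) (φ : (Lang m).Sentence) : Prop :=
  ∃ S : Fin m → Set (Fin n),
    @FirstOrder.Language.Sentence.Realize (Lang m) (Fin n) (structOf G S) φ

/-! ### First-order definable properties -/

/-- A property of a graph, a vertex set and a sequence of vertices which is expressed by a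
first-order formula over `L_1`. -/
def IsFO (P : ∀ n, SimpleGraph (Fin n) → Set (Fin n) → (ℕ → Fin n) → Prop) : Prop :=
  ∃ φ : (Lang 1).Formula ℕ, ∀ n (G : SimpleGraph (Fin n)) (S : Set (Fin n)) (v : ℕ → Fin n),
    @Language.Formula.Realize (Lang 1) (Fin n) (structOf G fun _ => S) ℕ φ v ↔ P n G S v

namespace IsFO

variable {P Q : ∀ n, SimpleGraph (Fin n) → Set (Fin n) → (ℕ → Fin n) → Prop}

theorem adj (i j : ℕ) : IsFO fun _ G _ v => G.Adj (v i) (v j) := by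
  refine ⟨Language.Relations.formula₂ (L := Lang 1) (show (Lang 1).Relations 2 from ())
    (Language.Term.var i) (Language.Term.var j), fun n G S v => ?_⟩
  let _ := structOf G fun _ : Fin 1 => S
  exact Language.Formula.realize_rel₂

theorem mem (i : ℕ) : IsFO fun _ _ S v => v i ∈ S := by
  refine ⟨Language.Relations.formula₁ (L := Lang 1) (show (Lang 1).Relations 1 from (0 : Fin 1))
    (Language.Term.var i), fun n G S v => ?_⟩
  let _ := structOf G fun _ : Fin 1 => S
  exact Language.Formula.realize_rel₁

theorem eq (i j : ℕ) : IsFO fun _ _ _ v => v i = v j := by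
  refine ⟨Language.Term.equal (Language.Term.var i) (Language.Term.var j), fun n G S v => ?_⟩
  let _ := structOf G fun _ : Fin 1 => S
  exact Language.Formula.realize_equal

theorem not (hP : IsFO P) : IsFO fun n G S v => ¬ P n G S v := by
  obtain ⟨φ, hφ⟩ := hP
  refine ⟨φ.not, fun n G S v => ?_⟩
  let _ := structOf G fun _ : Fin 1 => S
  exact Language.Formula.realize_not.trans (not_congr (hφ n G S v))

theorem imp (hP : IsFO P) (hQ : IsFO Q) : IsFO fun n G S v => P n G S v → Q n G S v := by
  obtain ⟨φ, hφ⟩ := hP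
  obtain ⟨ψ, hψ⟩ := hQ
  refine ⟨φ.imp ψ, fun n G S v => ?_⟩
  let _ := structOf G fun _ : Fin 1 => S
  exact Language.Formula.realize_imp.trans (imp_congr (hφ n G S v) (hψ n G S v))

theorem and (hP : IsFO P) (hQ : IsFO Q) : IsFO fun n G S v => P n G S v ∧ Q n G S v := by
  obtain ⟨φ, hφ⟩ := hP
  obtain ⟨ψ, hψ⟩ := hQ
  refine ⟨φ ⊓ ψ, fun n G S v => ?_⟩
  let _ := structOf G fun _ : Fin 1 => S
  exact Language.Formula.realize_inf.trans (and_congr (hφ n G S v) (hψ n G S v))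

theorem or (hP : IsFO P) (hQ : IsFO Q) : IsFO fun n G S v => P n G S v ∨ Q n G S v := by
  simpa only [or_iff_not_imp_left] using hP.not.imp hQ

theorem iff (hP : IsFO P) (hQ : IsFO Q) : IsFO fun n G S v => (P n G S v ↔ Q n G S v) := by
  simpa only [iff_iff_implies_and_implies] using (hP.imp hQ).and (hQ.imp hP)

theorem ex {R : ∀ n, SimpleGraph (Fin n) → Set (Fin n) → (ℕ → Fin n) → Fin n → Prop}
    (h : IsFO fun n G S v => R n G S (fun k => v (k + 1)) (v 0)) :
    IsFO fun n G S v => ∃ x, R n G S v x := by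
  obtain ⟨φ, hφ⟩ := h
  refine ⟨Language.Formula.iExs Unit (φ.relabel fun k : ℕ =>
    (Nat.casesOn k (Sum.inr ()) Sum.inl : ℕ ⊕ Unit)), fun n G S v => ?_⟩
  let _ := structOf G fun _ : Fin 1 => S
  refine Language.Formula.realize_iExs.trans ⟨?_, ?_⟩
  · rintro ⟨i, hi⟩
    exact ⟨i (), (hφ n G S _).1 (Language.Formula.realize_relabel.1 hi)⟩
  · rintro ⟨x, hx⟩
    exact ⟨fun _ => x, Language.Formula.realize_relabel.2 ((hφ n G S _).2 hx)⟩

theorem all {R : ∀ n, SimpleGraph (Fin n) → Set (Fin n) → (ℕ → Fin n) → Fin n → Prop}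
    (h : IsFO fun n G S v => R n G S (fun k => v (k + 1)) (v 0)) :
    IsFO fun n G S v => ∀ x, R n G S v x := by
  have := (ex (R := fun n G S v x => ¬ R n G S v x) h.not).not
  simpa only [not_exists, not_not] using this

/-- A definable property `∃ x, R x` without further free variables is expressed by a sentence. -/
theorem exists_sentence {R : ∀ n, SimpleGraph (Fin n) → Set (Fin n) → Fin n → Prop}
    (h : IsFO fun n G S v => R n G S (v 0)) :
    ∃ φ : (Lang 1).Sentence, ∀ n (G : SimpleGraph (Fin n)),
      EMSOSat G φ ↔ ∃ S x, R n G S x := by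
  obtain ⟨φ, hφ⟩ := h
  refine ⟨Language.Formula.iExs Unit (φ.relabel fun _ : ℕ => (Sum.inr () : Empty ⊕ Unit)),
    fun n G => ?_⟩
  have key : ∀ S : Set (Fin n),
      @Language.Sentence.Realize (Lang 1) (Fin n) (structOf G fun _ => S)
        (Language.Formula.iExs Unit (φ.relabel fun _ : ℕ => (Sum.inr () : Empty ⊕ Unit))) ↔
      ∃ x, R n G S x := by
    intro S
    let _ := structOf G fun _ : Fin 1 => S
    refine Language.Formula.realize_iExs.trans ⟨?_, ?_⟩
    · rintro ⟨i, hi⟩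
      exact ⟨i (), (hφ n G S _).1 (Language.Formula.realize_relabel.1 hi)⟩
    · rintro ⟨x, hx⟩
      exact ⟨fun _ => x, Language.Formula.realize_relabel.2 ((hφ n G S fun _ => x).2 hx)⟩
  constructor
  · rintro ⟨S, hS⟩
    obtain ⟨S, rfl⟩ : ∃ T : Set (Fin n), S = fun _ => T :=
      ⟨S 0, funext fun i => by rw [Subsingleton.elim i 0]⟩
    exact ⟨S, (key S).1 hS⟩
  · rintro ⟨S, hS⟩
    exact ⟨fun _ => S, (key S).2 hS⟩

end IsFO

/-! ### The property expressed by the sentence -/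

section Encoding

variable {V : Type*} (G : SimpleGraph V) (S : Set V) (z : V)

/-- The vertices of `S` adjacent to `z`: the universe of the structure encoded by `S`. -/
def Core (x : V) : Prop := x ∈ S ∧ G.Adj z x

/-- The vertices of `S` not adjacent to `z`: they encode the non-adjacent pairs of the
structure. -/
def Wit (w : V) : Prop := w ∈ S ∧ ¬ G.Adj z w

/-- The binary relation encoded by `S`: two vertices are related unless they have a common
neighbour among the witnesses. -/
def CodeRel (x y : V) : Prop := x ≠ y ∧ ¬ ∃ w, Wit G S z w ∧ G.Adj w x ∧ G.Adj w y

/-- The unary predicate on the core given by the constant `c`. -/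
def Layer (c x : V) : Prop := Core G S z x ∧ CodeRel G S z c x

/-- The elements satisfying `P'` represent, via `Q`, exactly once each set of elements
satisfying `P` (on finite universes). -/
def IsPowerLayer (P P' : V → Prop) (Q : V → V → Prop) : Prop :=
  (∀ x, P' x → ∀ y, P' y → (∀ t, P t → (Q t x ↔ Q t y)) → x = y) ∧
  (∃ x, P' x ∧ ∀ t, P t → ¬ Q t x) ∧
  ∀ x, P' x → ∀ t, P t → ∃ y, P' y ∧ ∀ s, P s → (Q s y ↔ Q s x ∨ s = t)

/-- `S` is dominating and encodes a structure consisting of four constants and four layers,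
each of the last three layers being the power set of the previous one. -/
def Encodes : Prop :=
  ∃ c₀ c₁ c₂ c₃,
    (∀ x, Core G S z x → x = c₀ ∨ x = c₁ ∨ x = c₂ ∨ x = c₃ ∨
      Layer G S z c₀ x ∨ Layer G S z c₁ x ∨ Layer G S z c₂ x ∨ Layer G S z c₃ x) ∧
    IsPowerLayer (Layer G S z c₀) (Layer G S z c₁) (CodeRel G S z) ∧
    IsPowerLayer (Layer G S z c₁) (Layer G S z c₂) (CodeRel G S z) ∧
    IsPowerLayer (Layer G S z c₂) (Layer G S z c₃) (CodeRel G S z) ∧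
    (∀ w, Wit G S z w → ∃ a b, (Core G S z a ∧ Core G S z b) ∧
      (G.Adj w a ∧ G.Adj w b) ∧ ∀ w', Wit G S z w' → G.Adj w' a → G.Adj w' b → w' = w) ∧
    ∀ v, v ∈ S ∨ ∃ s, s ∈ S ∧ G.Adj s v

end Encoding

theorem exists_sentence_encodes :
    ∃ φ : (Lang 1).Sentence, ∀ n (G : SimpleGraph (Fin n)),
      EMSOSat G φ ↔ ∃ S z, Encodes G S z := by
  apply IsFO.exists_sentence (R := fun _ G S z => Encodes G S z)
  simp only [Encodes, IsPowerLayer, Layer, CodeRel, Core, Wit]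
  repeat' first
    | exact IsFO.adj _ _
    | exact IsFO.mem _
    | exact IsFO.eq _ _
    | apply IsFO.ex
    | apply IsFO.and
    | apply IsFO.or
    | apply IsFO.iff
    | apply IsFO.all
    | apply IsFO.not
    | apply IsFO.imp

/-! ### Sizes of encoding sets -/

theorem IsPowerLayer.ncard_eq {V : Type*} [Finite V] {P P' : V → Prop} {Q : V → V → Prop}
    (h : IsPowerLayer P P' Q) : {x | P' x}.ncard = 2 ^ {x | P x}.ncard := by
  obtain ⟨hext, ⟨e, he, hempty⟩, hins⟩ := h
  rw [← Set.ncard_powerset _ (Set.toFinite _)]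
  refine Set.ncard_congr (fun x _ => {t | P t ∧ Q t x}) (fun x _ t ht => ht.1) ?_ ?_
  · intro x y hx hy hxy
    refine hext x hx y hy fun t ht => ?_
    have := Set.ext_iff.1 hxy t
    simpa [ht] using this
  · intro A hA
    induction A, Set.toFinite A using Set.Finite.induction_on with
    | empty => exact ⟨e, he, by ext t; simpa using hempty t⟩
    | @insert t A _ _ ih =>
      obtain ⟨x, hx, rfl⟩ := ih ((Set.subset_insert _ _).trans hA)
      obtain ⟨y, hy, hyx⟩ := hins x hx t (hA (Set.mem_insert _ _))
      refine ⟨y, hy, ?_⟩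
      ext s
      simp only [Set.mem_ofPred_eq, Set.mem_insert_iff]
      constructor
      · rintro ⟨hs, hsy⟩
        rcases (hyx s hs).1 hsy with h | h
        · exact Or.inr ⟨hs, h⟩
        · exact Or.inl h
      · rintro (rfl | ⟨hs, hsx⟩)
        · have := hA (Set.mem_insert s _)
          exact ⟨this, (hyx s this).2 (Or.inr rfl)⟩
        · exact ⟨hs, (hyx s hs).2 (Or.inl hsx)⟩

/-- The size of the last layer of an encoded structure whose first layer has `j` elements. -/
def topSize (j : ℕ) : ℕ := 2 ^ 2 ^ 2 ^ j

theorem Encodes.exists_size {V : Type*} [Finite V] {G : SimpleGraph V} {S : Set V} {z : V}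
    (h : Encodes G S z) :
    ∃ j, topSize j ≤ Nat.card V ∧ S.ncard ≤ 30 * topSize j ^ 2 := by
  obtain ⟨c₀, c₁, c₂, c₃, hcov, h₁, h₂, h₃, hw, -⟩ := h
  replace h₁ := h₁.ncard_eq
  replace h₂ := h₂.ncard_eq
  replace h₃ := h₃.ncard_eq
  set j := {x | Layer G S z c₀ x}.ncard
  set T := {x | Layer G S z c₃ x}.ncard with hT
  have hTj : T = topSize j := by rw [topSize, ← h₁, ← h₂, ← h₃]
  refine ⟨j, hTj ▸ Set.ncard_le_card _, ?_⟩
  rw [← hTj]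
  have hj : j < 2 ^ j := Nat.lt_two_pow_self
  have h12 : {x | Layer G S z c₁ x}.ncard < {x | Layer G S z c₂ x}.ncard :=
    h₂ ▸ Nat.lt_two_pow_self
  have h23 : {x | Layer G S z c₂ x}.ncard < T := h₃ ▸ Nat.lt_two_pow_self
  have hT4 : 4 ≤ T := by
    rw [hTj]
    calc 4 = 2 ^ 2 ^ 2 ^ 0 := by norm_num
      _ ≤ topSize j := by unfold topSize; gcongr <;> omega
  have hcore : {x | Core G S z x}.ncard ≤ 5 * T := by
    have hsub : {x | Core G S z x} ⊆ (({c₀, c₁, c₂, c₃} : Set V) ∪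
        ({x | Layer G S z c₀ x} ∪ {x | Layer G S z c₁ x})) ∪
        ({x | Layer G S z c₂ x} ∪ {x | Layer G S z c₃ x}) := by
      intro x hx
      have := hcov x hx
      simp only [Set.mem_union, Set.mem_insert_iff, Set.mem_singleton_iff, Set.mem_ofPred_eq]
      tauto
    have e1 := Set.ncard_le_ncard hsub
    have e2 := Set.ncard_union_le (({c₀, c₁, c₂, c₃} : Set V) ∪
        ({x | Layer G S z c₀ x} ∪ {x | Layer G S z c₁ x}))
        ({x | Layer G S z c₂ x} ∪ {x | Layer G S z c₃ x})
    have e3 := Set.ncard_union_le ({c₀, c₁, c₂, c₃} : Set V)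
        ({x | Layer G S z c₀ x} ∪ {x | Layer G S z c₁ x})
    have e4 := Set.ncard_union_le {x | Layer G S z c₀ x} {x | Layer G S z c₁ x}
    have e5 := Set.ncard_union_le {x | Layer G S z c₂ x} {x | Layer G S z c₃ x}
    have e6 : ({c₀, c₁, c₂, c₃} : Set V).ncard ≤ 4 := by
      have a1 := Set.ncard_insert_le c₀ {c₁, c₂, c₃}
      have a2 := Set.ncard_insert_le c₁ {c₂, c₃}
      have a3 := Set.ncard_insert_le c₂ {c₃}
      have a4 := Set.ncard_singleton c₃
      omega
    omega
  have hwit : {w | Wit G S z w}.ncard ≤ {x | Core G S z x}.ncard ^ 2 := by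
    choose! a b hab hadj huniq using hw
    rw [sq, ← Set.ncard_prod]
    refine Set.ncard_le_ncard_of_injOn (fun w => (a w, b w))
      (fun w hw => Set.mk_mem_prod (hab w hw).1 (hab w hw).2) ?_
    intro w hw w' hw' heq
    obtain ⟨h1, h2⟩ := Prod.mk.inj heq
    exact (huniq w' hw' w hw (h1 ▸ (hadj w hw).1) (h2 ▸ (hadj w hw).2))
  have hS : S ⊆ {x | Core G S z x} ∪ {w | Wit G S z w} := by
    intro s hs
    by_cases h : G.Adj z s
    · exact Or.inl ⟨hs, h⟩
    · exact Or.inr ⟨hs, h⟩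
  calc S.ncard ≤ _ := Set.ncard_le_ncard hS
    _ ≤ _ := Set.ncard_union_le _ _
    _ ≤ 5 * T + (5 * T) ^ 2 := add_le_add hcore (hwit.trans (Nat.pow_le_pow_left hcore 2))
    _ ≤ 30 * T ^ 2 := by nlinarith

/-! ### Realizing the encoded structure -/

/-- The vertices `d` and the witnesses `f` realize the graph `H` around `z`: the `d i` are
neighbours of `z`, and each non-edge of `H` has a witness, not adjacent to `z`, whose only
neighbours among the `d i` are the ends of the non-edge. Every remaining vertex has a neighbour
among the witnesses. -/
structure IsRealization {κ V : Type*} (H : SimpleGraph κ) (G : SimpleGraph V) (z : V)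
    (d : κ → V) (f : Hᶜ.edgeSet → V) : Prop where
  inj : Function.Injective d
  adj : ∀ i, G.Adj z (d i)
  not_adj : ∀ e, ¬ G.Adj z (f e)
  trace : ∀ e i, G.Adj (f e) (d i) ↔ i ∈ (e : Sym2 κ)
  dominates : ∀ v, v ≠ z → v ∉ Set.range d → v ∉ Set.range f → ∃ e, G.Adj v (f e)

namespace IsRealization

variable {κ V : Type*} {H : SimpleGraph κ} {G : SimpleGraph V} {z : V} {d : κ → V}
  {f : Hᶜ.edgeSet → V}

theorem core_iff (h : IsRealization H G z d f) (x : V) :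
    Core G (Set.range d ∪ Set.range f) z x ↔ ∃ i, d i = x := by
  constructor
  · rintro ⟨hx | ⟨e, rfl⟩, hz⟩
    · exact hx
    · exact absurd hz (h.not_adj e)
  · rintro ⟨i, rfl⟩
    exact ⟨Or.inl ⟨i, rfl⟩, h.adj i⟩

theorem wit_iff (h : IsRealization H G z d f) (x : V) :
    Wit G (Set.range d ∪ Set.range f) z x ↔ ∃ e, f e = x := by
  constructor
  · rintro ⟨⟨i, rfl⟩ | hx, hz⟩
    · exact absurd (h.adj i) hz
    · exact hx
  · rintro ⟨e, rfl⟩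
    exact ⟨Or.inr ⟨e, rfl⟩, h.not_adj e⟩

theorem codeRel_iff (h : IsRealization H G z d f) (i k : κ) :
    CodeRel G (Set.range d ∪ Set.range f) z (d i) (d k) ↔ H.Adj i k := by
  by_cases hik : i = k
  · simp [hik, CodeRel]
  simp only [CodeRel, h.wit_iff, ne_eq, h.inj.eq_iff, hik, not_false_eq_true, true_and]
  constructor
  · intro hn
    by_contra hH
    refine hn ⟨_, ⟨⟨s(i, k), ?_⟩, rfl⟩, ?_, ?_⟩
    · simpa [SimpleGraph.compl_adj] using ⟨hik, hH⟩
    all_goals simp [h.trace]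
  · rintro hH ⟨_, ⟨e, rfl⟩, hi, hk⟩
    rw [h.trace] at hi hk
    have he := e.2
    rw [(Sym2.mem_and_mem_iff hik).1 ⟨hi, hk⟩, SimpleGraph.mem_edgeSet,
      SimpleGraph.compl_adj] at he
    exact he.2 hH

theorem layer_iff (h : IsRealization H G z d f) (c : κ) (x : V) :
    Layer G (Set.range d ∪ Set.range f) z (d c) x ↔ ∃ i, H.Adj c i ∧ d i = x := by
  rw [Layer, h.core_iff]
  constructor
  · rintro ⟨⟨i, rfl⟩, hi⟩
    exact ⟨i, (h.codeRel_iff _ _).1 hi, rfl⟩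
  · rintro ⟨i, hi, rfl⟩
    exact ⟨⟨i, rfl⟩, (h.codeRel_iff _ _).2 hi⟩

end IsRealization

/-- The universe of the structure to be encoded: four constants, `j` atoms, and the elements of
the first three levels of the hierarchy of sets above the atoms. -/
abbrev Tower (j : ℕ) : Type :=
  Fin 4 ⊕ (Fin j ⊕ (Finset (Fin j) ⊕
    (Finset (Finset (Fin j)) ⊕ Finset (Finset (Finset (Fin j))))))

/-- Each constant is related to the elements of one level, and each element of a level to the
sets containing it. -/
def towerRel (j : ℕ) : Tower j → Tower j → Prop
  | .inl c, .inr (.inl _) => c = 0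
  | .inl c, .inr (.inr (.inl _)) => c = 1
  | .inl c, .inr (.inr (.inr (.inl _))) => c = 2
  | .inl c, .inr (.inr (.inr (.inr _))) => c = 3
  | .inr (.inl a), .inr (.inr (.inl s)) => a ∈ s
  | .inr (.inr (.inl a)), .inr (.inr (.inr (.inl s))) => a ∈ s
  | .inr (.inr (.inr (.inl a))), .inr (.inr (.inr (.inr s))) => a ∈ s
  | _, _ => False

/-- The graph to be encoded. -/
def towerGraph (j : ℕ) : SimpleGraph (Tower j) := SimpleGraph.fromRel (towerRel j)

theorem isPowerLayer_of_mem_iff {A V : Type*} [DecidableEq A] {u : A → V} {u' : Finset A → V}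
    {P P' : V → Prop} {Q : V → V → Prop} (hP : ∀ x, P x ↔ ∃ a, u a = x)
    (hP' : ∀ x, P' x ↔ ∃ s, u' s = x) (hu : Function.Injective u)
    (hQ : ∀ a s, Q (u a) (u' s) ↔ a ∈ s) : IsPowerLayer P P' Q := by
  simp only [IsPowerLayer, hP, hP']
  refine ⟨?_, ⟨u' ∅, ⟨∅, rfl⟩, ?_⟩, ?_⟩
  · rintro _ ⟨s, rfl⟩ _ ⟨s', rfl⟩ h
    congr 1
    ext a
    simpa [hQ] using h _ ⟨a, rfl⟩
  · rintro _ ⟨a, rfl⟩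
    simp [hQ]
  · rintro _ ⟨s, rfl⟩ _ ⟨a, rfl⟩
    refine ⟨_, ⟨insert a s, rfl⟩, ?_⟩
    rintro _ ⟨b, rfl⟩
    simp [hQ, hu.eq_iff, or_comm]

theorem IsRealization.encodes {V : Type*} {j : ℕ} {G : SimpleGraph V} {z : V} {d : Tower j → V}
    {f : (towerGraph j)ᶜ.edgeSet → V} (h : IsRealization (towerGraph j) G z d f) :
    Encodes G (Set.range d ∪ Set.range f) z := by
  have l0 : ∀ x, Layer G (Set.range d ∪ Set.range f) z (d (.inl 0)) x ↔
      ∃ a, (fun a => d (.inr (.inl a))) a = x := fun x => by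
    rw [h.layer_iff]
    simp [towerGraph, towerRel]
  have l1 : ∀ x, Layer G (Set.range d ∪ Set.range f) z (d (.inl 1)) x ↔
      ∃ a, (fun a => d (.inr (.inr (.inl a)))) a = x := fun x => by
    rw [h.layer_iff]
    simp [towerGraph, towerRel]
  have l2 : ∀ x, Layer G (Set.range d ∪ Set.range f) z (d (.inl 2)) x ↔
      ∃ a, (fun a => d (.inr (.inr (.inr (.inl a))))) a = x := fun x => by
    rw [h.layer_iff]
    simp [towerGraph, towerRel]
  have l3 : ∀ x, Layer G (Set.range d ∪ Set.range f) z (d (.inl 3)) x ↔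
      ∃ a, (fun a => d (.inr (.inr (.inr (.inr a))))) a = x := fun x => by
    rw [h.layer_iff]
    simp [towerGraph, towerRel]
  refine ⟨d (.inl 0), d (.inl 1), d (.inl 2), d (.inl 3), ?_,
    isPowerLayer_of_mem_iff l0 l1 (fun a b hab => by simpa using h.inj hab) ?_,
    isPowerLayer_of_mem_iff l1 l2 (fun a b hab => by simpa using h.inj hab) ?_,
    isPowerLayer_of_mem_iff l2 l3 (fun a b hab => by simpa using h.inj hab) ?_, ?_, ?_⟩
  · intro x hx
    obtain ⟨i, rfl⟩ := (h.core_iff x).1 hx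
    simp only [l0, l1, l2, l3, h.inj.eq_iff]
    rcases i with i | i | i | i | i
    · fin_cases i <;> simp
    all_goals simp
  · intro a s
    rw [h.codeRel_iff]
    simp [towerGraph, towerRel]
  · intro a s
    rw [h.codeRel_iff]
    simp [towerGraph, towerRel]
  · intro a s
    rw [h.codeRel_iff]
    simp [towerGraph, towerRel]
  · intro w hw
    obtain ⟨e, rfl⟩ := (h.wit_iff w).1 hw
    obtain ⟨⟨a, b⟩, he⟩ := e
    have hab : a ≠ b := (show (towerGraph j)ᶜ.Adj a b from he).ne
    refine ⟨d a, d b, ⟨(h.core_iff _).2 ⟨a, rfl⟩, (h.core_iff _).2 ⟨b, rfl⟩⟩, ?_, ?_⟩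
    · rw [h.trace, h.trace]
      exact ⟨Sym2.mem_mk_left a b, Sym2.mem_mk_right a b⟩
    · intro w' hw' ha hb
      obtain ⟨e', rfl⟩ := (h.wit_iff w').1 hw'
      rw [h.trace] at ha hb
      congr 1
      exact Subtype.ext ((Sym2.mem_and_mem_iff hab).1 ⟨ha, hb⟩)
  · intro v
    by_cases hv : v = z
    · exact Or.inr ⟨_, Or.inl ⟨.inl 0, rfl⟩, hv ▸ (h.adj _).symm⟩
    by_cases hd : v ∈ Set.range d
    · exact Or.inl (Or.inl hd)
    by_cases hf : v ∈ Set.range f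
    · exact Or.inl (Or.inr hf)
    obtain ⟨e, he⟩ := h.dominates v hv hd hf
    exact Or.inr ⟨_, Or.inr ⟨e, rfl⟩, he.symm⟩

theorem card_tower_le (j : ℕ) : Fintype.card (Tower j) ≤ 8 * topSize j := by
  have h1 : j < 2 ^ j := Nat.lt_two_pow_self
  have h2 : 2 ^ j < 2 ^ 2 ^ j := Nat.lt_two_pow_self
  have h3 : 2 ^ 2 ^ j < topSize j := Nat.lt_two_pow_self
  simp only [Fintype.card_sum, Fintype.card_fin, Fintype.card_finset]
  change 4 + (j + (2 ^ j + (2 ^ 2 ^ j + topSize j))) ≤ _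
  omega

theorem topSize_sq_le_card_edgeSet (j : ℕ) :
    topSize j ^ 2 ≤ 4 * Nat.card (towerGraph j)ᶜ.edgeSet := by
  set A := Finset (Finset (Finset (Fin j))) with hA
  have hT : Nat.card A = topSize j := by
    simp [hA, topSize]
  have hle : Nat.card ((⊤ : SimpleGraph A).edgeSet) ≤ Nat.card (towerGraph j)ᶜ.edgeSet := by
    let g : A → Tower j := fun a => .inr (.inr (.inr (.inr a)))
    have hg : Function.Injective g := fun a b hab => by simpa [g] using hab
    let φ : (⊤ : SimpleGraph A) →g (towerGraph j)ᶜ :=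
      ⟨g, fun {a b} hab => by
        rw [SimpleGraph.compl_adj]
        refine ⟨fun h => hab (hg h), ?_⟩
        simp [g, towerGraph, towerRel]⟩
    exact Nat.card_le_card_of_injective φ.mapEdgeSet (SimpleGraph.Hom.mapEdgeSet.injective φ hg)
  have hc : Nat.card ((⊤ : SimpleGraph A).edgeSet) = (topSize j).choose 2 := by
    rw [← hT, Nat.card_eq_fintype_card, Nat.card_eq_fintype_card,
      ← SimpleGraph.card_edgeFinset_top_eq_card_choose_two, SimpleGraph.edgeFinset_card]
  rw [hc, Nat.choose_two_right] at hle
  have h2 : 2 ≤ topSize j := by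
    unfold topSize
    calc 2 = 2 ^ 1 := rfl
      _ ≤ _ := Nat.pow_le_pow_right (by norm_num) Nat.one_le_two_pow
  obtain ⟨t, ht⟩ : ∃ t, topSize j = t + 2 := ⟨_, (Nat.sub_add_cancel h2).symm⟩
  rw [ht] at hle ⊢
  have hd : (t + 2) * (t + 2 - 1) / 2 * 2 = (t + 2) * (t + 2 - 1) :=
    Nat.div_mul_cancel (Nat.even_mul_pred_self _).two_dvd
  have : (t + 2) * (t + 2 - 1) = (t + 2) * (t + 1) := rfl
  nlinarith

/-! ### Probabilities in `G(n,p)` -/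

section Probability

open scoped Classical in
/-- The probability of the graph `G`. -/
def graphWeight {n : ℕ} (p : ℝ) (G : SimpleGraph (Fin n)) : ℝ :=
  ∏ e ∈ (⊤ : SimpleGraph (Fin n)).edgeFinset, if e ∈ G.edgeSet then p else 1 - p

/-- The property `A` depends only on the pairs in `T`. -/
def DetBy {V : Type*} (T : Set (Sym2 V)) (A : SimpleGraph V → Prop) : Prop :=
  ∀ ⦃G G' : SimpleGraph V⦄, (∀ e ∈ T, e ∈ G.edgeSet ↔ e ∈ G'.edgeSet) → (A G ↔ A G')

variable {n : ℕ} {p : ℝ}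

open scoped Classical in
theorem graphWeight_eq (G : SimpleGraph (Fin n)) :
    graphWeight p G = p ^ edgeCt G * (1 - p) ^ (n * (n - 1) / 2 - edgeCt G) := by
  have hsub : G.edgeFinset ⊆ (⊤ : SimpleGraph (Fin n)).edgeFinset :=
    SimpleGraph.edgeFinset_mono le_top
  have h1 : (⊤ : SimpleGraph (Fin n)).edgeFinset.filter (· ∈ G.edgeSet) = G.edgeFinset := by
    ext e
    simp only [Finset.mem_filter, SimpleGraph.mem_edgeFinset]
    exact ⟨fun h => h.2, fun h => ⟨SimpleGraph.edgeSet_mono le_top h, h⟩⟩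
  have h2 : (⊤ : SimpleGraph (Fin n)).edgeFinset.filter (· ∉ G.edgeSet) =
      (⊤ : SimpleGraph (Fin n)).edgeFinset \ G.edgeFinset := by
    ext e
    simp
  have hc : edgeCt G = G.edgeFinset.card := by
    rw [edgeCt, Nat.card_eq_fintype_card, SimpleGraph.edgeFinset_card]
  rw [graphWeight, Finset.prod_ite, Finset.prod_const, Finset.prod_const, h1, h2, hc,
    Finset.card_sdiff_of_subset hsub, SimpleGraph.card_edgeFinset_top_eq_card_choose_two,
    Fintype.card_fin, Nat.choose_two_right]

open scoped Classical in
theorem prob_eq_sum_graphWeight (Q : SimpleGraph (Fin n) → Prop) :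
    prob n p Q = ∑ G, if Q G then graphWeight p G else 0 := by
  simp only [prob, graphWeight_eq]

theorem graphWeight_nonneg (hp : 0 ≤ p) (hp' : p ≤ 1) (G : SimpleGraph (Fin n)) :
    0 ≤ graphWeight p G := by
  refine Finset.prod_nonneg fun e _ => ?_
  split_ifs <;> linarith

open scoped Classical in
theorem sum_graph_prod_ite (a b : Sym2 (Fin n) → ℝ) :
    ∑ G : SimpleGraph (Fin n), ∏ e ∈ (⊤ : SimpleGraph (Fin n)).edgeFinset,
      (if e ∈ G.edgeSet then a e else b e) =
    ∏ e ∈ (⊤ : SimpleGraph (Fin n)).edgeFinset, (a e + b e) := by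
  rw [Finset.prod_add]
  refine Finset.sum_bij' (fun G _ => G.edgeFinset)
    (fun t _ => SimpleGraph.fromEdgeSet (t : Set (Sym2 (Fin n)))) ?_ ?_ ?_ ?_ ?_
  · exact fun G _ => Finset.mem_powerset.2 (SimpleGraph.edgeFinset_mono le_top)
  · simp
  · intro G _
    simp
  · intro t ht
    ext e
    have : e ∈ t → ¬ e.IsDiag := fun h => by
      simpa using Finset.mem_powerset.1 ht h
    simp only [SimpleGraph.mem_edgeFinset, SimpleGraph.edgeSet_fromEdgeSet]
    simpa using this
  · intro G _
    have h1 : (⊤ : SimpleGraph (Fin n)).edgeFinset.filter (· ∈ G.edgeSet) = G.edgeFinset := by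
      ext e
      simp only [Finset.mem_filter, SimpleGraph.mem_edgeFinset]
      exact ⟨fun h => h.2, fun h => ⟨SimpleGraph.edgeSet_mono le_top h, h⟩⟩
    have h2 : (⊤ : SimpleGraph (Fin n)).edgeFinset.filter (· ∉ G.edgeSet) =
        (⊤ : SimpleGraph (Fin n)).edgeFinset \ G.edgeFinset := by
      ext e
      simp
    rw [Finset.prod_ite, h1, h2]

theorem prob_nonneg (hp : 0 ≤ p) (hp' : p ≤ 1) (Q : SimpleGraph (Fin n) → Prop) :
    0 ≤ prob n p Q := by
  rw [prob_eq_sum_graphWeight]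
  refine Finset.sum_nonneg fun G _ => ?_
  split_ifs
  exacts [graphWeight_nonneg hp hp' G, le_rfl]

theorem prob_mono (hp : 0 ≤ p) (hp' : p ≤ 1) {Q R : SimpleGraph (Fin n) → Prop}
    (h : ∀ G, Q G → R G) : prob n p Q ≤ prob n p R := by
  rw [prob_eq_sum_graphWeight, prob_eq_sum_graphWeight]
  refine Finset.sum_le_sum fun G _ => ?_
  have := graphWeight_nonneg hp hp' G
  by_cases hQ : Q G
  · simp [hQ, h G hQ]
  · rw [if_neg hQ]
    split_ifs
    exacts [this, le_rfl]

theorem prob_true : prob n p (fun _ => True) = 1 := by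
  rw [prob_eq_sum_graphWeight]
  simp only [if_true, graphWeight]
  rw [sum_graph_prod_ite]
  simp

theorem prob_false : prob n p (fun _ => False) = 0 := by
  simp [prob]

theorem prob_not (Q : SimpleGraph (Fin n) → Prop) :
    prob n p (fun G => ¬ Q G) = 1 - prob n p Q := by
  rw [← prob_true (n := n) (p := p), prob_eq_sum_graphWeight, prob_eq_sum_graphWeight,
    prob_eq_sum_graphWeight, ← Finset.sum_sub_distrib]
  refine Finset.sum_congr rfl fun G _ => ?_
  by_cases h : Q G <;> simp [h]

theorem prob_exists_mem_le (hp : 0 ≤ p) (hp' : p ≤ 1) {ι : Type*} (s : Finset ι)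
    (A : ι → SimpleGraph (Fin n) → Prop) :
    prob n p (fun G => ∃ i ∈ s, A i G) ≤ ∑ i ∈ s, prob n p (A i) := by
  simp only [prob_eq_sum_graphWeight]
  rw [Finset.sum_comm]
  refine Finset.sum_le_sum fun G _ => ?_
  have hnn : ∀ i ∈ s, 0 ≤ (open scoped Classical in
      if A i G then graphWeight p G else 0) := fun i _ => by
    split_ifs
    exacts [graphWeight_nonneg hp hp' G, le_rfl]
  split_ifs with h
  · obtain ⟨i, hi, hA⟩ := h
    have := Finset.single_le_sum hnn hi
    rwa [if_pos hA] at this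
  · exact Finset.sum_nonneg hnn

theorem prob_exists_le (hp : 0 ≤ p) (hp' : p ≤ 1) {ι : Type*} [Fintype ι]
    (A : ι → SimpleGraph (Fin n) → Prop) {ε : ℝ} (h : ∀ i, prob n p (A i) ≤ ε) :
    prob n p (fun G => ∃ i, A i G) ≤ Fintype.card ι * ε := by
  have := prob_exists_mem_le hp hp' Finset.univ A
  simp only [Finset.mem_univ, true_and] at this
  refine this.trans ((Finset.sum_le_sum fun i _ => h i).trans ?_)
  simp

theorem prob_or_le (hp : 0 ≤ p) (hp' : p ≤ 1) (A B : SimpleGraph (Fin n) → Prop) :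
    prob n p (fun G => A G ∨ B G) ≤ prob n p A + prob n p B := by
  have := prob_exists_mem_le hp hp' Finset.univ (fun b : Bool => cond b B A)
  simpa [add_comm] using this

/-! ### Independence -/

/-- The graph which agrees with `G` on the pairs in `T` and with `G'` elsewhere. -/
def mixGraph {V : Type*} (T : Set (Sym2 V)) (G G' : SimpleGraph V) : SimpleGraph V where
  Adj a b := (s(a, b) ∈ T ∧ G.Adj a b) ∨ (s(a, b) ∉ T ∧ G'.Adj a b)
  symm := ⟨fun a b => by rw [Sym2.eq_swap, G.adj_comm, G'.adj_comm]; exact id⟩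
  loopless := ⟨fun a => by simp⟩

theorem mem_mixGraph {V : Type*} {T : Set (Sym2 V)} {G G' : SimpleGraph V} {e : Sym2 V} :
    e ∈ (mixGraph T G G').edgeSet ↔
      (e ∈ T ∧ e ∈ G.edgeSet) ∨ (e ∉ T ∧ e ∈ G'.edgeSet) := by
  induction e with
  | h a b => rfl

theorem mixGraph_mixGraph {V : Type*} (T : Set (Sym2 V)) (G G' : SimpleGraph V) :
    mixGraph T (mixGraph T G G') (mixGraph T G' G) = G := by
  rw [← SimpleGraph.edgeSet_inj]
  ext e
  simp only [mem_mixGraph]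
  tauto

theorem graphWeight_mixGraph (T : Set (Sym2 (Fin n))) (G G' : SimpleGraph (Fin n)) :
    graphWeight p (mixGraph T G G') * graphWeight p (mixGraph T G' G) =
      graphWeight p G * graphWeight p G' := by
  simp only [graphWeight, ← Finset.prod_mul_distrib]
  refine Finset.prod_congr rfl fun e _ => ?_
  by_cases hT : e ∈ T <;> by_cases h : e ∈ G.edgeSet <;> by_cases h' : e ∈ G'.edgeSet <;>
    simp [mem_mixGraph, hT, h, h', mul_comm]

/-- Properties depending on disjoint sets of pairs are independent. -/
theorem prob_and_of_detBy {T : Set (Sym2 (Fin n))} {A B : SimpleGraph (Fin n) → Prop}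
    (hA : DetBy T A) (hB : DetBy Tᶜ B) :
    prob n p (fun G => A G ∧ B G) = prob n p A * prob n p B := by
  classical
  rw [← mul_one (prob n p fun G => A G ∧ B G), ← prob_true (n := n) (p := p)]
  simp only [prob_eq_sum_graphWeight, Finset.sum_mul_sum, ← Fintype.sum_prod_type']
  let σ : SimpleGraph (Fin n) × SimpleGraph (Fin n) ≃ SimpleGraph (Fin n) × SimpleGraph (Fin n) :=
    { toFun := fun x => (mixGraph T x.1 x.2, mixGraph T x.2 x.1)
      invFun := fun x => (mixGraph T x.1 x.2, mixGraph T x.2 x.1)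
      left_inv := fun x => by simp [mixGraph_mixGraph]
      right_inv := fun x => by simp [mixGraph_mixGraph] }
  rw [← σ.sum_comp]
  refine Finset.sum_congr rfl fun x _ => ?_
  have h1 : A (mixGraph T x.1 x.2) ↔ A x.1 := hA fun e he => by
    simp [mem_mixGraph, he]
  have h2 : B (mixGraph T x.1 x.2) ↔ B x.2 := hB fun e he => by
    simp [mem_mixGraph, (Set.mem_compl_iff _ _).1 he]
  have h3 := graphWeight_mixGraph (p := p) T x.1 x.2
  have h4 : σ x = (mixGraph T x.1 x.2, mixGraph T x.2 x.1) := rfl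
  by_cases hA' : A x.1 <;> by_cases hB' : B x.2 <;> simp [h1, h2, h4, hA', hB', h3]

theorem prob_forall_mem_of_detBy {ι : Type*} (s : Finset ι) {T : ι → Set (Sym2 (Fin n))}
    {A : ι → SimpleGraph (Fin n) → Prop} (hA : ∀ i ∈ s, DetBy (T i) (A i))
    (hT : ∀ i ∈ s, ∀ k ∈ s, i ≠ k → Disjoint (T i) (T k)) :
    prob n p (fun G => ∀ i ∈ s, A i G) = ∏ i ∈ s, prob n p (A i) := by
  classical
  induction s using Finset.induction_on with
  | empty => simp [prob_true]
  | insert i s hi ih =>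
    rw [Finset.prod_insert hi, ← ih (fun k hk => hA k (Finset.mem_insert_of_mem hk))
      fun k hk l hl => hT k (Finset.mem_insert_of_mem hk) l (Finset.mem_insert_of_mem hl),
      ← prob_and_of_detBy (hA i (Finset.mem_insert_self i s))]
    · simp
    · intro G G' h
      refine forall₂_congr fun k hk => hA k (Finset.mem_insert_of_mem hk) fun e he => h e ?_
      exact Set.disjoint_right.1 (hT i (Finset.mem_insert_self i s) k (Finset.mem_insert_of_mem hk)
        (fun h => hi (h ▸ hk))) he

open scoped Classical in
theorem prob_cylinder (T : Finset (Sym2 (Fin n))) (hT : ∀ e ∈ T, ¬ e.IsDiag)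
    (U : Set (Sym2 (Fin n))) :
    prob n p (fun G => ∀ e ∈ T, e ∈ G.edgeSet ↔ e ∈ U) =
      ∏ e ∈ T, if e ∈ U then p else 1 - p := by
  have key : ∀ G : SimpleGraph (Fin n),
      (if ∀ e ∈ T, e ∈ G.edgeSet ↔ e ∈ U then graphWeight p G else 0) =
      ∏ e ∈ (⊤ : SimpleGraph (Fin n)).edgeFinset, if e ∈ G.edgeSet then
        (if e ∈ T ∧ e ∉ U then 0 else p) else (if e ∈ T ∧ e ∈ U then 0 else 1 - p) := by
    intro G
    split_ifs with h
    · refine Finset.prod_congr rfl fun e _ => ?_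
      by_cases heT : e ∈ T
      · by_cases heU : e ∈ U <;> simp [h e heT, heU]
      · simp [heT]
    · push Not at h
      obtain ⟨e, heT, he⟩ := h
      rw [Finset.prod_eq_zero (i := e)]
      · simpa using hT e heT
      · by_cases heU : e ∈ U <;> simp_all
  have hTt : T ⊆ (⊤ : SimpleGraph (Fin n)).edgeFinset := fun e he => by simpa using hT e he
  rw [prob_eq_sum_graphWeight, Finset.sum_congr rfl fun G _ => by convert key G,
    sum_graph_prod_ite, ← Finset.prod_subset hTt]
  · refine Finset.prod_congr rfl fun e he => ?_
    by_cases heU : e ∈ U <;> simp [he, heU]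
  · intro e _ he
    simp [he]

/-- A property which is unlikely for each fixed choice stays unlikely for a choice made
independently of it. -/
theorem prob_choice_le {ι : Type*} [Fintype ι] (hp : 0 ≤ p) (hp' : p ≤ 1)
    (X : SimpleGraph (Fin n) → ι)
    (B : ι → SimpleGraph (Fin n) → Prop) (T : ι → Set (Sym2 (Fin n)))
    (hX : ∀ c, DetBy (T c) fun G => X G = c) (hB : ∀ c, DetBy (T c)ᶜ (B c)) {ε : ℝ}
    (h : ∀ c, prob n p (B c) ≤ ε) : prob n p (fun G => B (X G) G) ≤ ε := by
  classical
  calc prob n p (fun G => B (X G) G)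
      ≤ prob n p (fun G => ∃ c ∈ Finset.univ, X G = c ∧ B c G) :=
        prob_mono hp hp' fun G hG => ⟨X G, Finset.mem_univ _, rfl, hG⟩
    _ ≤ ∑ c, prob n p (fun G => X G = c ∧ B c G) := prob_exists_mem_le hp hp' _ _
    _ = ∑ c, prob n p (fun G => X G = c) * prob n p (B c) :=
        Finset.sum_congr rfl fun c _ => prob_and_of_detBy (hX c) (hB c)
    _ ≤ ∑ c, prob n p (fun G => X G = c) * ε :=
        Finset.sum_le_sum fun c _ => mul_le_mul_of_nonneg_left (h c) (prob_nonneg hp hp' _)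
    _ = ε := by
        rw [← Finset.sum_mul]
        simp only [prob_eq_sum_graphWeight]
        rw [Finset.sum_comm]
        have := prob_true (n := n) (p := p)
        rw [prob_eq_sum_graphWeight] at this
        simp only [if_true] at this
        simp [this]

end Probability

/-! ### Existence of realizations -/

section Existence

variable {n : ℕ} {p : ℝ} {κ : Type*} [Fintype κ] {H : SimpleGraph κ} {z : Fin n}
  {B : κ → Finset (Fin n)} {K : Finset (Fin n)}

theorem prob_forall_not_adj_le (hp : 0 ≤ p) (hp' : p ≤ 1) {v : Fin n} {s : Finset (Fin n)}
    (hv : v ∉ s) {L : ℕ} (hL : L ≤ s.card) :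
    prob n p (fun G => ∀ x ∈ s, ¬ G.Adj v x) ≤ (1 - p) ^ L := by
  classical
  have h := prob_cylinder (p := p) (s.image fun x => s(v, x)) (by
    simp only [Finset.mem_image]
    rintro _ ⟨x, hx, rfl⟩ hd
    exact hv (by rwa [Sym2.mk_isDiag_iff.1 hd])) ∅
  simp only [Finset.forall_mem_image, SimpleGraph.mem_edgeSet, Set.mem_empty_iff_false,
    iff_false, if_false] at h
  rw [h, Finset.prod_const, Finset.card_image_of_injective _ fun x y => Sym2.congr_right.1]
  exact pow_le_pow_of_le_one (by linarith) (by linarith) hL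

variable (H) in
/-- `w` is a witness for the pair `e`. -/
def IsWitnessFor (G : SimpleGraph (Fin n)) (z : Fin n) (d : κ → Fin n) (e : Hᶜ.edgeSet)
    (w : Fin n) : Prop :=
  ¬ G.Adj z w ∧ ∀ i, G.Adj w (d i) ↔ i ∈ (e : Sym2 κ)

omit [Fintype κ] in
theorem detBy_isWitnessFor {d : κ → Fin n} (hzK : z ∉ K) (hdK : ∀ i, d i ∉ K)
    (e : Hᶜ.edgeSet) (w : Fin n) :
    DetBy {e | ∃ y, y ∉ K ∧ e = s(w, y)} fun G => IsWitnessFor H G z d e w := by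
  intro G G' h
  have h1 : G.Adj z w ↔ G'.Adj z w := by
    rw [G.adj_comm, G'.adj_comm]
    exact h s(w, z) ⟨z, hzK, rfl⟩
  have h2 : ∀ i, G.Adj w (d i) ↔ G'.Adj w (d i) := fun i => h s(w, d i) ⟨d i, hdK i, rfl⟩
  simp only [IsWitnessFor, h1, h2]

theorem le_prob_isWitnessFor (hp : 0 ≤ p) (hp' : p ≤ 1) {d : κ → Fin n}
    (hd : Function.Injective d) (hdz : ∀ i, d i ≠ z) {w : Fin n} (hwz : w ≠ z)
    (hwd : ∀ i, d i ≠ w) (e : Hᶜ.edgeSet) :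
    p ^ 2 * (1 - p) ^ Fintype.card κ ≤ prob n p fun G => IsWitnessFor H G z d e w := by
  classical
  have hinj : Function.Injective fun i => s(w, d i) := fun i k hik => hd (Sym2.congr_right.1 hik)
  have hnot : s(w, z) ∉ Finset.univ.image fun i => s(w, d i) := by
    simpa only [Finset.mem_image, Finset.mem_univ, true_and, Sym2.congr_right, not_exists] using hdz
  have h := prob_cylinder (p := p) (insert s(w, z) (Finset.univ.image fun i => s(w, d i))) (by
    simp only [Finset.mem_insert, Finset.mem_image, Finset.mem_univ, true_and]
    rintro _ (rfl | ⟨i, rfl⟩) h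
    · exact hwz (by simpa using h)
    · exact hwd i (by simpa using h.symm)) ((fun i => s(w, d i)) '' {i | i ∈ (e : Sym2 κ)})
  have hz : s(w, z) ∉ (fun i => s(w, d i)) '' {i | i ∈ (e : Sym2 κ)} := by
    rintro ⟨i, -, hi⟩
    exact hnot (Finset.mem_image.2 ⟨i, Finset.mem_univ _, hi⟩)
  have hm : ∀ i, s(w, d i) ∈ (fun i => s(w, d i)) '' {i | i ∈ (e : Sym2 κ)} ↔
      i ∈ (e : Sym2 κ) := fun i => hinj.mem_set_image
  rw [Finset.prod_insert hnot, Finset.prod_image fun i _ k _ hik => hinj hik, if_neg hz] at h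
  simp only [hm, Finset.forall_mem_insert, Finset.forall_mem_image, Finset.mem_univ,
    forall_true_left, hz, iff_false, SimpleGraph.mem_edgeSet, Finset.prod_ite,
    Finset.prod_const] at h
  have hcard : (Finset.univ.filter fun i => i ∈ (e : Sym2 κ)).card = 2 := by
    have hnd : ¬ (e : Sym2 κ).IsDiag := Hᶜ.not_isDiag_of_mem_edgeSet e.2
    rw [← Sym2.card_toFinset_of_not_isDiag _ hnd]
    congr 1
    ext i
    simp
  have hcard' := Finset.card_filter_add_card_filter_not (s := (Finset.univ : Finset κ))
    (fun i => i ∈ (e : Sym2 κ))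
  have hE : prob n p (fun G => IsWitnessFor H G z d e w) =
      (1 - p) * (p ^ 2 * (1 - p) ^ (Finset.univ.filter fun i => i ∉ (e : Sym2 κ)).card) := by
    rw [← hcard, ← h]
    simp only [IsWitnessFor, SimpleGraph.adj_comm _ z w]
  rw [hE, mul_left_comm, ← pow_succ']
  refine mul_le_mul_of_nonneg_left (pow_le_pow_of_le_one (by linarith) (by linarith) ?_)
    (by positivity)
  rw [Finset.card_univ] at hcard'
  omega

theorem prob_not_exists_isWitnessFor_le (hp : 0 ≤ p) (hp' : p ≤ 1) {d : κ → Fin n}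
    (hd : Function.Injective d) (hdz : ∀ i, d i ≠ z) (hzK : z ∉ K) (hdK : ∀ i, d i ∉ K)
    {k : ℕ} (hk : k ≤ K.card) (e : Hᶜ.edgeSet) :
    prob n p (fun G => ¬ ∃ w ∈ K, IsWitnessFor H G z d e w) ≤
      (1 - p ^ 2 * (1 - p) ^ Fintype.card κ) ^ k := by
  have hq : p ^ 2 * (1 - p) ^ Fintype.card κ ≤ 1 :=
    mul_le_one₀ (pow_le_one₀ hp hp') (pow_nonneg (by linarith) _)
      (pow_le_one₀ (by linarith) (by linarith))
  have hq' : 0 ≤ p ^ 2 * (1 - p) ^ Fintype.card κ :=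
    mul_nonneg (by positivity) (pow_nonneg (by linarith) _)
  push Not
  rw [prob_forall_mem_of_detBy K (T := fun w => {e | ∃ y, y ∉ K ∧ e = s(w, y)})]
  · calc ∏ w ∈ K, prob n p (fun G => ¬ IsWitnessFor H G z d e w)
        ≤ ∏ w ∈ K, (1 - p ^ 2 * (1 - p) ^ Fintype.card κ) := by
          refine Finset.prod_le_prod (fun w _ => prob_nonneg hp hp' _) fun w hw => ?_
          rw [prob_not]
          have := le_prob_isWitnessFor hp hp' hd hdz (w := w) (fun h => hzK (h ▸ hw))
            (fun i h => hdK i (h ▸ hw)) e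
          linarith
      _ ≤ _ := by
          rw [Finset.prod_const]
          exact pow_le_pow_of_le_one (by linarith) (by linarith) hk
  · intro w _ G G' h
    exact not_congr (detBy_isWitnessFor hzK hdK e w h)
  · intro w hw w' hw' hne
    rw [Set.disjoint_left]
    rintro _ ⟨y, hy, rfl⟩ ⟨y', hy', h⟩
    rcases Sym2.eq_iff.1 h with h | h
    · exact hne h.1
    · exact hy' (h.1 ▸ hw)

/-- A vertex of each block adjacent to `z`, if there is one. -/
def coreChoice (B : κ → Finset (Fin n)) (z : Fin n) (G : SimpleGraph (Fin n)) (i : κ) : Fin n :=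
  @Classical.epsilon _ ⟨z⟩ fun x => x ∈ B i ∧ G.Adj z x

variable (H) in
/-- A witness in `K` for each non-edge of `H`, if there is one. -/
def witChoice (K : Finset (Fin n)) (z : Fin n) (d : κ → Fin n) (G : SimpleGraph (Fin n))
    (e : Hᶜ.edgeSet) : Fin n :=
  @Classical.epsilon _ ⟨z⟩ fun w => w ∈ K ∧ IsWitnessFor H G z d e w

omit [Fintype κ] in
theorem coreChoice_congr {G G' : SimpleGraph (Fin n)} (h : ∀ i, ∀ x ∈ B i, G.Adj z x ↔ G'.Adj z x) :
    coreChoice B z G = coreChoice B z G' := by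
  funext i
  unfold coreChoice
  congr 1
  funext x
  exact propext (and_congr_right fun hx => h i x hx)

omit [Fintype κ] in
theorem witChoice_congr {d : κ → Fin n} {G G' : SimpleGraph (Fin n)}
    (hz : ∀ x, G.Adj z x ↔ G'.Adj z x) (hd : ∀ i x, G.Adj x (d i) ↔ G'.Adj x (d i)) :
    witChoice H K z d G = witChoice H K z d G' := by
  funext e
  unfold witChoice
  congr 1
  funext x
  simp only [IsWitnessFor, hz, hd]

theorem prob_not_exists_isRealization_le (hp : 0 ≤ p) (hp' : p ≤ 1)
    (hB : ∀ i k, i ≠ k → Disjoint (B i) (B k)) (hzB : ∀ i, z ∉ B i)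
    (hBK : ∀ i, Disjoint (B i) K) (hzK : z ∉ K) {L k : ℕ} (hL : ∀ i, L ≤ (B i).card)
    (hk : k ≤ K.card) :
    prob n p (fun G => ¬ ∃ d f, IsRealization H G z d f) ≤
      Fintype.card κ * (1 - p) ^ L +
      (Nat.card Hᶜ.edgeSet * (1 - p ^ 2 * (1 - p) ^ Fintype.card κ) ^ k +
      n * (1 - p) ^ Nat.card Hᶜ.edgeSet) := by
  classical
  have hnn : 0 ≤ 1 - p := by linarith
  have hq : p ^ 2 * (1 - p) ^ Fintype.card κ ≤ 1 :=
    mul_le_one₀ (pow_le_one₀ hp hp') (pow_nonneg hnn _) (pow_le_one₀ hnn (by linarith))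
  have hqk : 0 ≤ (1 - p ^ 2 * (1 - p) ^ Fintype.card κ) ^ k := pow_nonneg (by linarith) _
  have hgood : ∀ {d : κ → Fin n}, (∀ i, d i ∈ B i) →
      Function.Injective d ∧ (∀ i, d i ≠ z) ∧ ∀ i, d i ∉ K := by
    intro d hd
    refine ⟨fun i k hik => ?_, fun i h => hzB i (h ▸ hd i),
      fun i => Finset.disjoint_left.1 (hBK i) (hd i)⟩
    by_contra hne
    exact Finset.disjoint_left.1 (hB i k hne) (hd i) (hik ▸ hd k)
  have h₁ : prob n p (fun G => ∃ i, ∀ x ∈ B i, ¬ G.Adj z x) ≤ Fintype.card κ * (1 - p) ^ L :=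
    prob_exists_le hp hp' _ fun i => prob_forall_not_adj_le hp hp' (hzB i) (hL i)
  let bad₂ : (κ → Fin n) → SimpleGraph (Fin n) → Prop := fun d G =>
    (∀ i, d i ∈ B i) ∧ ∃ e : Hᶜ.edgeSet, ¬ ∃ w ∈ K, IsWitnessFor H G z d e w
  have h₂ : prob n p (fun G => bad₂ (coreChoice B z G) G) ≤
      Nat.card Hᶜ.edgeSet * (1 - p ^ 2 * (1 - p) ^ Fintype.card κ) ^ k := by
    refine prob_choice_le hp hp' (coreChoice B z) bad₂
      (fun _ => {e | ∃ i, ∃ x ∈ B i, e = s(z, x)}) ?_ ?_ ?_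
    · intro d G G' h
      change coreChoice B z G = d ↔ coreChoice B z G' = d
      rw [coreChoice_congr fun i x hx => h s(z, x) ⟨i, x, hx, rfl⟩]
    · intro d G G' h
      refine and_congr_right fun hd => exists_congr fun e => not_congr <|
        exists_congr fun w => and_congr_right fun hw => ?_
      refine detBy_isWitnessFor hzK (hgood hd).2.2 e w ?_
      rintro _ ⟨y, hy, rfl⟩
      refine h _ ?_
      rintro ⟨i, x, hx, hwx⟩
      rcases Sym2.eq_iff.1 hwx with h | h
      · exact hzK (h.1 ▸ hw)
      · exact Finset.disjoint_left.1 (hBK i) hx (h.1 ▸ hw)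
    · intro d
      by_cases hd : ∀ i, d i ∈ B i
      · obtain ⟨hinj, hdz, hdK⟩ := hgood hd
        simp only [bad₂, hd, implies_true, true_and]
        rw [Nat.card_eq_fintype_card]
        exact prob_exists_le hp hp' _ fun e =>
          prob_not_exists_isWitnessFor_le hp hp' hinj hdz hzK hdK hk e
      · simp only [bad₂, hd, false_and, prob_false]
        positivity
  let bad₃ : (κ → Fin n) × (Hᶜ.edgeSet → Fin n) → SimpleGraph (Fin n) → Prop := fun c G =>
    ((∀ i, c.1 i ∈ B i) ∧ (∀ e, c.2 e ∈ K) ∧ Function.Injective c.2) ∧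
      ∃ v, (v ≠ z ∧ v ∉ Set.range c.1 ∧ v ∉ Set.range c.2) ∧ ∀ e, ¬ G.Adj v (c.2 e)
  have h₃ : prob n p (fun G => bad₃ (coreChoice B z G, witChoice H K z (coreChoice B z G) G) G) ≤
      n * (1 - p) ^ Nat.card Hᶜ.edgeSet := by
    refine prob_choice_le hp hp'
      (fun G => (coreChoice B z G, witChoice H K z (coreChoice B z G) G)) bad₃
      (fun c => {e | z ∈ e ∨ ∃ i, c.1 i ∈ e}) ?_ ?_ ?_
    · intro c G G' h
      have hz : ∀ x, G.Adj z x ↔ G'.Adj z x := fun x => h s(z, x) (Or.inl (by simp))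
      simp only [Prod.ext_iff]
      rw [coreChoice_congr fun i x _ => hz x]
      refine and_congr_right fun hc => ?_
      rw [hc, witChoice_congr hz fun i x => h s(x, c.1 i) (Or.inr ⟨i, by simp⟩)]
    · intro c G G' h
      refine and_congr_right fun hc => exists_congr fun v => and_congr_right fun hv =>
        forall_congr' fun e => not_congr (h s(v, c.2 e) ?_)
      obtain ⟨hdB, hfK, -⟩ := hc
      rintro (hz | ⟨i, hi⟩)
      · rcases Sym2.mem_iff.1 hz with h | h
        · exact hv.1 h.symm
        · exact hzK (h ▸ hfK e)
      · rcases Sym2.mem_iff.1 hi with h | h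
        · exact hv.2.1 ⟨i, h⟩
        · exact (hgood hdB).2.2 i (h ▸ hfK e)
    · intro c
      by_cases hc : (∀ i, c.1 i ∈ B i) ∧ (∀ e, c.2 e ∈ K) ∧ Function.Injective c.2
      · have hcard : (Finset.univ.image c.2).card = Nat.card Hᶜ.edgeSet := by
          rw [Finset.card_image_of_injective _ hc.2.2, Finset.card_univ,
            Nat.card_eq_fintype_card]
        have := prob_exists_le hp hp' (n := n) (fun (v : Fin n) G =>
          (v ≠ z ∧ v ∉ Set.range c.1 ∧ v ∉ Set.range c.2) ∧ ∀ e, ¬ G.Adj v (c.2 e))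
          (ε := (1 - p) ^ Nat.card Hᶜ.edgeSet) fun v => ?_
        · simpa only [bad₃, hc, implies_true, true_and, Fintype.card_fin] using this
        · by_cases hv : v ≠ z ∧ v ∉ Set.range c.1 ∧ v ∉ Set.range c.2
          · refine le_trans (prob_mono hp hp' fun G hG => ?_)
              (prob_forall_not_adj_le (v := v) (s := Finset.univ.image c.2) hp hp' ?_ hcard.ge)
            · exact Finset.forall_mem_image.2 fun e _ => hG.2 e
            · simpa using hv.2.2
          · simp only [hv, false_and, prob_false]
            positivity
      · simp only [bad₃, hc, false_and, prob_false]
        positivity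
  refine (prob_mono hp hp' fun G hG => ?_).trans
    ((prob_or_le hp hp' (fun G => ∃ i, ∀ x ∈ B i, ¬ G.Adj z x) _).trans (add_le_add h₁
      ((prob_or_le hp hp' (fun G => bad₂ (coreChoice B z G) G)
        (fun G => bad₃ (coreChoice B z G, witChoice H K z (coreChoice B z G) G) G)).trans
        (add_le_add h₂ h₃))))
  by_contra hcon
  rw [not_or, not_or] at hcon
  obtain ⟨g₁, g₂, g₃⟩ := hcon
  refine hG ?_
  push Not at g₁
  have hd : ∀ i, coreChoice B z G i ∈ B i ∧ G.Adj z (coreChoice B z G i) := fun i =>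
    Classical.epsilon_spec (g₁ i)
  set d := coreChoice B z G
  simp only [bad₂, not_and, not_exists] at g₂
  have hf : ∀ e, witChoice H K z d G e ∈ K ∧ IsWitnessFor H G z d e (witChoice H K z d G e) :=
    fun e => Classical.epsilon_spec (by simpa using g₂ (fun i => (hd i).1) e)
  set f := witChoice H K z d G
  have hfinj : Function.Injective f := by
    intro e e' hee
    refine Subtype.ext (Sym2.ext fun i => ?_)
    rw [← (hf e).2.2, ← (hf e').2.2, hee]
  refine ⟨d, f, (hgood fun i => (hd i).1).1, fun i => (hd i).2, fun e => (hf e).2.1,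
    fun e => (hf e).2.2, fun v hz hvd hvf => ?_⟩
  by_contra hcon
  push Not at hcon
  exact g₃ ⟨⟨fun i => (hd i).1, fun e => (hf e).1, hfinj⟩, v, ⟨hz, hvd, hvf⟩, hcon⟩

end Existence

/-! ### Non-existence of small dominating sets -/

section Domination

variable {n : ℕ} {p : ℝ}

theorem prob_adj (hp : 0 ≤ p) {u v : Fin n} : prob n p (fun G => G.Adj u v) ≤ p := by
  classical
  by_cases h : u = v
  · simpa [h, prob_false] using hp
  · have := prob_cylinder (p := p) {s(u, v)} (by simpa using h) Set.univ
    simpa using this.le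

theorem prob_dominating_range_le (hp : 0 ≤ p) (hp' : p ≤ 1) {K : ℕ} (hK : K * p ≤ 1)
    (s : Fin K → Fin n) :
    prob n p (fun G => ∀ v, v ∈ Set.range s ∨ ∃ i, G.Adj v (s i)) ≤ (K * p) ^ (n - K) := by
  classical
  have hcard : n - K ≤ (Finset.univ.image s)ᶜ.card := by
    rw [Finset.card_compl, Fintype.card_fin]
    have : (Finset.univ.image s).card ≤ K := by
      simpa using Finset.card_image_le (s := Finset.univ) (f := s)
    omega
  calc prob n p (fun G => ∀ v, v ∈ Set.range s ∨ ∃ i, G.Adj v (s i))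
      ≤ prob n p (fun G => ∀ v ∈ (Finset.univ.image s)ᶜ, ∃ i, G.Adj v (s i)) := by
        refine prob_mono hp hp' fun G hG v hv => (hG v).resolve_left ?_
        simpa using hv
    _ = ∏ v ∈ (Finset.univ.image s)ᶜ, prob n p (fun G => ∃ i, G.Adj v (s i)) := by
        refine prob_forall_mem_of_detBy _ (T := fun v => {e | ∃ i, e = s(v, s i)})
          (fun v _ G G' h => exists_congr fun i => h s(v, s i) ⟨i, rfl⟩) ?_
        intro v hv w hw hvw
        rw [Set.disjoint_left]
        rintro _ ⟨i, rfl⟩ ⟨k, h⟩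
        rcases Sym2.eq_iff.1 h with h | h
        · exact hvw h.1
        · simp only [Finset.mem_compl, Finset.mem_image, Finset.mem_univ, true_and] at hv
          exact hv ⟨k, h.1.symm⟩
    _ ≤ ∏ v ∈ (Finset.univ.image s)ᶜ, (K * p) := by
        refine Finset.prod_le_prod (fun v _ => prob_nonneg hp hp' _) fun v _ => ?_
        simpa using prob_exists_le hp hp' (fun i G => G.Adj v (s i)) fun i => prob_adj hp
    _ ≤ _ := by
        rw [Finset.prod_const]
        exact pow_le_pow_of_le_one (by positivity) hK hcard

theorem prob_exists_encodes_le (hp : 0 ≤ p) (hp' : p ≤ 1) {K : ℕ} (hK : K * p ≤ 1)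
    (h : ∀ j, topSize j ≤ n → 30 * topSize j ^ 2 ≤ K) :
    prob n p (fun G => ∃ S z, Encodes G S z) ≤ n ^ K * (K * p) ^ (n - K) := by
  have h₁ := prob_exists_le hp hp' _ fun s : Fin K → Fin n =>
    prob_dominating_range_le hp hp' hK s
  refine (prob_mono hp hp' fun G => ?_).trans (h₁.trans_eq (by simp))
  classical
  rintro ⟨S, z, hS⟩
  have hdom : ∀ v, v ∈ S ∨ ∃ s, s ∈ S ∧ G.Adj s v := by
    obtain ⟨_, _, _, _, _, _, _, _, _, hdom⟩ := hS
    exact hdom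
  have hne : S.Nonempty := by
    rcases hdom z with hz | ⟨s, hs, -⟩
    exacts [⟨z, hz⟩, ⟨s, hs⟩]
  obtain ⟨j, hj, hSj⟩ := hS.exists_size
  rw [Nat.card_eq_fintype_card, Fintype.card_fin] at hj
  have hSK : Fintype.card S ≤ Fintype.card (Fin K) := by
    rw [← Nat.card_eq_fintype_card, Nat.card_coe_set_eq, Fintype.card_fin]
    exact hSj.trans (h j hj)
  obtain ⟨g⟩ : Nonempty (S ↪ Fin K) := Function.Embedding.nonempty_of_card_le hSK
  have : Nonempty S := hne.to_subtype
  refine ⟨fun i => ((Function.invFun g i : S) : Fin n), fun v => ?_⟩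
  have hsurj := Function.invFun_surjective g.injective
  rcases hdom v with hv | ⟨s, hs, hadj⟩
  · obtain ⟨i, hi⟩ := hsurj ⟨v, hv⟩
    exact Or.inl ⟨i, by simp [hi]⟩
  · obtain ⟨i, hi⟩ := hsurj ⟨s, hs⟩
    exact Or.inr ⟨i, by simpa [hi] using hadj.symm⟩

end Domination

/-! ### Two subsequences -/

theorem lt_topSize (j : ℕ) : j < topSize j :=
  Nat.lt_two_pow_self.trans (Nat.lt_two_pow_self.trans Nat.lt_two_pow_self)

theorem topSize_mono : Monotone topSize := fun i j h => by
  unfold topSize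
  gcongr <;> omega

theorem prob_exists_encodes_le_quarter {α : ℝ} (h0 : 0 < α) {n K C : ℕ} (hC : 2 ≤ C)
    (hCα : 2 ≤ C * α) (hKC : K ^ C ≤ n) (hKα : 4 + α ≤ K * α) (hK4 : 4 ≤ K)
    (h : ∀ j, topSize j ≤ n → 30 * topSize j ^ 2 ≤ K) :
    prob n ((n : ℝ) ^ (-α)) (fun G => ∃ S z, Encodes G S z) ≤ 1 / 4 := by
  have hKn2 : K ^ 2 ≤ n := (Nat.pow_le_pow_right (by omega) hC).trans hKC
  have hKn : K ≤ n := by nlinarith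
  have hn : (1 : ℝ) ≤ n := by exact_mod_cast (show 1 ≤ n by omega)
  have hn0 : (0 : ℝ) < n := by linarith
  have hC0 : (0 : ℝ) < C := by exact_mod_cast (show 0 < C by omega)
  have hp : (0 : ℝ) ≤ (n : ℝ) ^ (-α) := by positivity
  have hp' : (n : ℝ) ^ (-α) ≤ 1 := Real.rpow_le_one_of_one_le_of_nonpos hn (by linarith)
  have hKr : (K : ℝ) ≤ (n : ℝ) ^ (α / 2) := by
    have h1 : ((K : ℝ) ^ C) ^ (1 / (C : ℝ)) ≤ (n : ℝ) ^ (1 / (C : ℝ)) :=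
      Real.rpow_le_rpow (by positivity) (by exact_mod_cast hKC) (by positivity)
    rw [← Real.rpow_natCast, ← Real.rpow_mul (by positivity), mul_one_div_cancel hC0.ne',
      Real.rpow_one] at h1
    refine h1.trans (Real.rpow_le_rpow_of_exponent_le hn ?_)
    rw [div_le_div_iff₀ hC0 two_pos]
    linarith
  have hKp : (K : ℝ) * (n : ℝ) ^ (-α) ≤ (n : ℝ) ^ (-(α / 2)) := by
    calc (K : ℝ) * (n : ℝ) ^ (-α) ≤ (n : ℝ) ^ (α / 2) * (n : ℝ) ^ (-α) := by gcongr
      _ = _ := by rw [← Real.rpow_add hn0]; ring_nf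
  have hle1 : (n : ℝ) ^ (-(α / 2)) ≤ 1 :=
    Real.rpow_le_one_of_one_le_of_nonpos hn (by linarith)
  refine (prob_exists_encodes_le hp hp' (hKp.trans hle1) h).trans ?_
  calc (n : ℝ) ^ K * (K * (n : ℝ) ^ (-α)) ^ (n - K)
      ≤ (n : ℝ) ^ K * ((n : ℝ) ^ (-(α / 2))) ^ (n - K) := by gcongr
    _ = (n : ℝ) ^ ((K : ℝ) - α / 2 * (n - K)) := by
        rw [← Real.rpow_natCast, ← Real.rpow_natCast, ← Real.rpow_mul hn0.le,
          ← Real.rpow_add hn0, Nat.cast_sub hKn]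
        ring_nf
    _ ≤ (n : ℝ) ^ (-1 : ℝ) := by
        refine Real.rpow_le_rpow_of_exponent_le hn ?_
        have h2 : (K : ℝ) ^ 2 ≤ n := by exact_mod_cast hKn2
        have h4 : (4 : ℝ) ≤ K := by exact_mod_cast hK4
        nlinarith [mul_le_mul_of_nonneg_left hKα (Nat.cast_nonneg (α := ℝ) K),
          mul_le_mul_of_nonneg_left h2 h0.le]
    _ ≤ 1 / 4 := by
        rw [Real.rpow_neg_one, inv_eq_one_div]
        refine one_div_le_one_div_of_le (by norm_num) ?_
        exact_mod_cast (show 4 ≤ n by omega)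

theorem exists_prob_exists_encodes_le {α : ℝ} (h0 : 0 < α) (N : ℕ) :
    ∃ n ≥ N, prob n ((n : ℝ) ^ (-α)) (fun G => ∃ S z, Encodes G S z) ≤ 1 / 4 := by
  obtain ⟨C, hC⟩ := exists_nat_ge (2 / α + 2)
  obtain ⟨M, hM⟩ := exists_nat_ge ((4 + α) / α)
  have h2α : 0 < 2 / α := by positivity
  have hC2 : 2 ≤ C := by
    have : (2 : ℝ) ≤ C := by linarith
    exact_mod_cast this
  set j := N + M + 4 * C + 5 with hj
  set a := 2 ^ 2 ^ j with ha
  have hja : j < a := Nat.lt_two_pow_self.trans Nat.lt_two_pow_self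
  have hT : topSize j = 2 ^ a := rfl
  have hT' : topSize (j + 1) = 2 ^ (a ^ 2) := by
    rw [topSize, ha, ← pow_mul, pow_succ 2 j]
  have hMK : j ≤ 30 * topSize j ^ 2 := by
    nlinarith [lt_topSize j]
  refine ⟨topSize (j + 1) - 1, ?_, prob_exists_encodes_le_quarter (K := 30 * topSize j ^ 2)
    (C := C) h0 hC2 ?_ ?_ ?_ (by omega) ?_⟩
  · have := lt_topSize (j + 1)
    omega
  · have : 2 / α ≤ C := by linarith
    rwa [div_le_iff₀ h0] at this
  · have h1 : (30 * topSize j ^ 2) ^ C ≤ 2 ^ ((5 + 2 * a) * C) := by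
      rw [pow_mul 2]
      refine Nat.pow_le_pow_left ?_ C
      rw [hT, pow_add, ← pow_mul, mul_comm a 2]
      gcongr
      norm_num
    have h2 : (5 + 2 * a) * C + 1 ≤ a ^ 2 := by nlinarith
    have h3 : 2 ^ ((5 + 2 * a) * C) * 2 ≤ topSize (j + 1) := by
      rw [hT', ← pow_succ]
      exact Nat.pow_le_pow_right two_pos h2
    have h4 : 0 < 2 ^ ((5 + 2 * a) * C) := by positivity
    omega
  · have : (M : ℝ) ≤ ((30 * topSize j ^ 2 : ℕ) : ℝ) := by exact_mod_cast (show M ≤ _ by omega)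
    rw [div_le_iff₀ h0] at hM
    nlinarith
  · intro i hi
    have hij : i ≤ j := by
      by_contra hlt
      have := topSize_mono (show j + 1 ≤ i by omega)
      have := lt_topSize (j + 1)
      omega
    have := topSize_mono hij
    gcongr

theorem prob_not_exists_encodes_le {n : ℕ} {p : ℝ} (hp : 0 ≤ p) (hp' : p ≤ 1) {j L k : ℕ}
    (h : Fintype.card (Tower j) * L + k + 1 ≤ n) :
    prob n p (fun G => ¬ ∃ S z, Encodes G S z) ≤
      Fintype.card (Tower j) * (1 - p) ^ L +
      (Nat.card (towerGraph j)ᶜ.edgeSet * (1 - p ^ 2 * (1 - p) ^ Fintype.card (Tower j)) ^ k +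
      n * (1 - p) ^ Nat.card (towerGraph j)ᶜ.edgeSet) := by
  classical
  obtain ⟨g⟩ : Nonempty (Option (Tower j × Fin L ⊕ Fin k) ↪ Fin n) := by
    refine Function.Embedding.nonempty_of_card_le ?_
    rwa [Fintype.card_option, Fintype.card_sum, Fintype.card_prod, Fintype.card_fin,
      Fintype.card_fin, Fintype.card_fin]
  refine (prob_mono hp hp' fun G hG => ?_).trans (prob_not_exists_isRealization_le
    (H := towerGraph j) (z := g none)
    (B := fun i => Finset.univ.image fun l => g (some (.inl (i, l))))
    (K := Finset.univ.image fun l => g (some (.inr l))) hp hp' ?_ ?_ ?_ ?_ (L := L) (k := k) ?_ ?_)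
  · rintro ⟨d, f, hdf⟩
    exact hG ⟨_, _, hdf.encodes⟩
  · intro i k hik
    simp [Finset.disjoint_left, hik.symm]
  · simp
  · simp [Finset.disjoint_left]
  · simp
  · intro i
    rw [Finset.card_image_of_injective _ fun l l' hl => by simpa using hl]
    simp
  · rw [Finset.card_image_of_injective _ fun l l' hl => by simpa using hl]
    simp

theorem card_compl_edgeSet_le {κ : Type*} [Fintype κ] (H : SimpleGraph κ) :
    Nat.card Hᶜ.edgeSet ≤ Fintype.card κ ^ 2 := by
  classical
  rw [Nat.card_eq_fintype_card, ← SimpleGraph.edgeFinset_card]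
  refine SimpleGraph.card_edgeFinset_le_card_choose_two.trans ?_
  exact Nat.choose_le_pow _ _

theorem eventually_sq_mul_exp_le {c η : ℝ} (hc : 0 < c) (hη : 0 < η) {ε : ℝ} (hε : 0 < ε) :
    ∀ᶠ n : ℕ in atTop, (n : ℝ) ^ 2 * Real.exp (-c * (n : ℝ) ^ η) ≤ ε := by
  have h1 := (tendsto_rpow_mul_exp_neg_mul_atTop_nhds_zero (2 / η) c hc).comp
    ((tendsto_rpow_atTop hη).comp tendsto_natCast_atTop_atTop)
  filter_upwards [h1.eventually_le_const hε] with n hn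
  have h2 : ((n : ℝ) ^ η) ^ (2 / η) = (n : ℝ) ^ 2 := by
    rw [← Real.rpow_mul (Nat.cast_nonneg n), mul_div_cancel₀ _ hη.ne', Real.rpow_two]
  simpa [h2] using hn

theorem one_sub_pow_le_exp {x t : ℝ} (hx : x ≤ 1) {k : ℕ} (h : t ≤ k * x) :
    (1 - x) ^ k ≤ Real.exp (-t) := by
  calc (1 - x) ^ k ≤ Real.exp (-x) ^ k :=
        pow_le_pow_left₀ (by linarith) (Real.one_sub_le_exp_neg x) k
    _ = Real.exp (-(k * x)) := by rw [← Real.exp_nat_mul]; ring_nf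
    _ ≤ _ := Real.exp_le_exp.2 (by linarith)

set_option maxHeartbeats 1000000 in
theorem eventually_le_prob_exists_encodes {α : ℝ} (h0 : 0 < α) (h1 : α < 1 / 2) :
    ∀ᶠ n : ℕ in atTop, ∀ j, (n : ℝ) ^ (3 * α / 4) ≤ topSize j →
      topSize j ≤ 2 * (n : ℝ) ^ (3 * α / 4) →
      3 / 4 ≤ prob n ((n : ℝ) ^ (-α)) (fun G => ∃ S z, Encodes G S z) := by
  have hcast := tendsto_natCast_atTop_atTop (R := ℝ)
  have hη : 0 < min (1 / 8) (min (1 - 2 * α) (α / 2)) := by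
    refine lt_min (by norm_num) (lt_min ?_ ?_) <;> linarith
  filter_upwards [eventually_ge_atTop 8,
    eventually_sq_mul_exp_le (c := 1 / 128) (by norm_num) hη (ε := 1 / 12) (by norm_num),
    ((tendsto_rpow_atTop (show 0 < 1 - 3 * α / 4 by linarith)).comp hcast).eventually_ge_atTop 128,
    ((tendsto_rpow_atTop (show 0 < α / 4 by linarith)).comp hcast).eventually_ge_atTop 32]
    with n hn8 hexp hlarge hlarge' j hjl hju
  set m := Fintype.card (Tower j) with hm
  set e := Nat.card (towerGraph j)ᶜ.edgeSet with he
  set p := (n : ℝ) ^ (-α) with hpdef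
  set η := min (1 / 8) (min (1 - 2 * α) (α / 2)) with hηdef
  have hη1 : η ≤ 1 / 8 := min_le_left _ _
  have hη2 : η ≤ 1 - 2 * α := (min_le_right _ _).trans (min_le_left _ _)
  have hη3 : η ≤ α / 2 := (min_le_right _ _).trans (min_le_right _ _)
  have hn : (8 : ℝ) ≤ n := by exact_mod_cast hn8
  have hn1 : (1 : ℝ) ≤ n := by linarith
  have hn0 : (0 : ℝ) < n := by linarith
  have hp : 0 < p := Real.rpow_pos_of_pos hn0 _
  have hp' : p ≤ 1 := Real.rpow_le_one_of_one_le_of_nonpos hn1 (by linarith)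
  have hm0 : 0 < m := Fintype.card_pos_iff.2 ⟨.inl 0⟩
  have hm0' : (0 : ℝ) < m := by exact_mod_cast hm0
  have hm16 : (m : ℝ) ≤ 16 * (n : ℝ) ^ (3 * α / 4) := by
    have : (m : ℝ) ≤ 8 * topSize j := by exact_mod_cast card_tower_le j
    linarith
  have hmn : 8 * (m : ℝ) ≤ n := by
    have : (n : ℝ) ^ (3 * α / 4) * (n : ℝ) ^ (1 - 3 * α / 4) = n := by
      rw [← Real.rpow_add hn0]
      ring_nf
      exact Real.rpow_one _
    simp only [Function.comp_apply] at hlarge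
    nlinarith [Real.rpow_pos_of_pos hn0 (3 * α / 4)]
  have hmp : (m : ℝ) * p ≤ 1 / 2 := by
    have : (n : ℝ) ^ (3 * α / 4) * p * (n : ℝ) ^ (α / 4) = 1 := by
      rw [hpdef, ← Real.rpow_add hn0, ← Real.rpow_add hn0]
      ring_nf
      exact Real.rpow_zero _
    simp only [Function.comp_apply] at hlarge'
    have hpos := mul_pos (Real.rpow_pos_of_pos hn0 (3 * α / 4)) hp
    nlinarith
  have hL1 : m * (n / (4 * m)) ≤ n / 4 := by
    rw [← Nat.div_div_eq_div_mul]
    exact Nat.mul_div_le _ _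
  have hbound := prob_not_exists_encodes_le hp.le hp' (j := j) (L := n / (4 * m)) (k := n / 4)
    (n := n) (by rw [← hm]; omega)
  have hL : (n : ℝ) / (8 * m) ≤ (n / (4 * m) : ℕ) := by
    have h1 := Nat.lt_div_mul_add (a := n) (b := 4 * m) (by omega)
    have h2 : (n : ℝ) < (n / (4 * m) : ℕ) * (4 * m) + 4 * m := by exact_mod_cast h1
    rw [div_le_iff₀ (by positivity)]
    nlinarith
  have hk : (n : ℝ) / 8 ≤ (n / 4 : ℕ) := by
    have h1 : n ≤ 8 * (n / 4) := by omega
    have h2 : (n : ℝ) ≤ 8 * (n / 4 : ℕ) := by exact_mod_cast h1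
    linarith
  have hpow : (1 / 2 : ℝ) ≤ (1 - p) ^ m := by
    have := one_add_mul_le_pow (a := -p) (by linarith) m
    rw [← sub_eq_add_neg] at this
    linarith
  have he4 : (n : ℝ) ^ (3 * α / 2) / 4 ≤ e := by
    have h1 : (topSize j : ℝ) ^ 2 ≤ 4 * e := by exact_mod_cast topSize_sq_le_card_edgeSet j
    have h2 : (n : ℝ) ^ (3 * α / 2) = ((n : ℝ) ^ (3 * α / 4)) ^ 2 := by
      rw [← Real.rpow_natCast, ← Real.rpow_mul hn0.le]
      ring_nf
    have h3 : ((n : ℝ) ^ (3 * α / 4)) ^ 2 ≤ (topSize j : ℝ) ^ 2 := by gcongr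
    linarith
  have hmn' : (m : ℝ) ≤ (n : ℝ) ^ 2 := by nlinarith
  have hem : (e : ℝ) ≤ (n : ℝ) ^ 2 := by
    have h1 : (e : ℝ) ≤ (m : ℝ) ^ 2 := by exact_mod_cast card_compl_edgeSet_le (towerGraph j)
    have h2 : (m : ℝ) ≤ n := by linarith
    exact h1.trans (by gcongr)
  have t1 : (1 - p) ^ (n / (4 * m)) ≤ Real.exp (-(1 / 128 * (n : ℝ) ^ η)) := by
    refine one_sub_pow_le_exp hp' ?_
    calc 1 / 128 * (n : ℝ) ^ η ≤ 1 / 128 * (n : ℝ) ^ (1 - 3 * α / 4 + -α) := by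
          gcongr
          linarith
      _ = (n : ℝ) / (8 * (16 * (n : ℝ) ^ (3 * α / 4))) * p := by
          rw [Real.rpow_add hn0, Real.rpow_sub hn0, Real.rpow_one]
          ring
      _ ≤ (n : ℝ) / (8 * m) * p := by gcongr
      _ ≤ _ := by gcongr
  have t2 : (1 - p ^ 2 * (1 - p) ^ m) ^ (n / 4) ≤ Real.exp (-(1 / 128 * (n : ℝ) ^ η)) := by
    refine one_sub_pow_le_exp (mul_le_one₀ (pow_le_one₀ hp.le hp')
      (pow_nonneg (by linarith) _) (pow_le_one₀ (by linarith) (by linarith))) ?_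
    have hpp : (n : ℝ) * p ^ 2 = (n : ℝ) ^ (1 - 2 * α) := by
      rw [hpdef, ← Real.rpow_natCast, ← Real.rpow_mul hn0.le, ← Real.rpow_one_add' hn0.le]
      · ring_nf
      · push_cast
        linarith
    calc 1 / 128 * (n : ℝ) ^ η ≤ 1 / 16 * (n : ℝ) ^ (1 - 2 * α) := by
          gcongr
          norm_num
      _ = (n : ℝ) / 8 * (p ^ 2 * (1 / 2)) := by rw [← hpp]; ring
      _ ≤ _ := by gcongr
  have t3 : (1 - p) ^ e ≤ Real.exp (-(1 / 128 * (n : ℝ) ^ η)) := by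
    refine one_sub_pow_le_exp hp' ?_
    calc 1 / 128 * (n : ℝ) ^ η ≤ 1 / 4 * (n : ℝ) ^ (3 * α / 2 + -α) := by
          gcongr
          · norm_num
          · linarith
      _ = (n : ℝ) ^ (3 * α / 2) / 4 * p := by
          rw [Real.rpow_add hn0]
          ring
      _ ≤ _ := by gcongr
  rw [neg_mul] at hexp
  have s1 : (m : ℝ) * (1 - p) ^ (n / (4 * m)) ≤ 1 / 12 :=
    le_trans (by gcongr) hexp
  have s2 : (e : ℝ) * (1 - p ^ 2 * (1 - p) ^ m) ^ (n / 4) ≤ 1 / 12 :=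
    le_trans (mul_le_mul hem t2 (pow_nonneg (sub_nonneg.2 (mul_le_one₀ (pow_le_one₀ hp.le hp')
      (pow_nonneg (by linarith) _) (pow_le_one₀ (by linarith) (by linarith)))) _)
      (by positivity)) hexp
  have s3 : (n : ℝ) * (1 - p) ^ e ≤ 1 / 12 :=
    le_trans (mul_le_mul (by nlinarith) t3 (pow_nonneg (by linarith) _) (by positivity)) hexp
  rw [prob_not] at hbound
  linarith

theorem exists_le_prob_exists_encodes {α : ℝ} (h0 : 0 < α) (h1 : α < 1 / 2) (N : ℕ) :
    ∃ n ≥ N, 3 / 4 ≤ prob n ((n : ℝ) ^ (-α)) (fun G => ∃ S z, Encodes G S z) := by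
  obtain ⟨N₀, hN₀⟩ := eventually_atTop.1 (eventually_le_prob_exists_encodes h0 h1)
  set j := N + N₀ + 1 with hj
  set T : ℝ := (topSize j : ℝ) with hT
  have hjT : (j : ℝ) + 1 ≤ T := by
    have hlt : j + 1 ≤ topSize j := lt_topSize j
    rw [hT]; exact_mod_cast hlt
  have hj0 : (0 : ℝ) ≤ j := Nat.cast_nonneg j
  have hT1 : 1 ≤ T := by linarith
  set x := T ^ (4 / (3 * α)) with hx
  have hTx : T ≤ x := by
    refine Real.self_le_rpow_of_one_le hT1 ?_
    rw [le_div_iff₀ (by positivity)]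
    linarith
  have hxT : x ^ (3 * α / 4) = T := by
    rw [hx, ← Real.rpow_mul (by linarith)]
    convert Real.rpow_one T using 2
    field_simp
  set n := ⌊x⌋₊ with hn
  have hnx : (n : ℝ) ≤ x := Nat.floor_le (by linarith)
  have hxn : x < n + 1 := Nat.lt_floor_add_one x
  have hjn : j ≤ n := Nat.le_floor (by linarith)
  have hn1 : (1 : ℝ) ≤ n := by exact_mod_cast (show 1 ≤ n by omega)
  refine ⟨n, by omega, hN₀ n (by omega) j ?_ ?_⟩
  · rw [← hT, ← hxT]
    exact Real.rpow_le_rpow (by linarith) hnx (by linarith)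
  · rw [← hT, ← hxT]
    calc x ^ (3 * α / 4) ≤ (2 * n) ^ (3 * α / 4) :=
          Real.rpow_le_rpow (by linarith) (by linarith) (by linarith)
      _ = 2 ^ (3 * α / 4) * (n : ℝ) ^ (3 * α / 4) := Real.mul_rpow (by norm_num) (by linarith)
      _ ≤ 2 ^ (1 : ℝ) * (n : ℝ) ^ (3 * α / 4) := by
          gcongr
          · norm_num
          · linarith
      _ = _ := by rw [Real.rpow_one]

/-- For every δ > 0 there exists a first-order sentence φ in the language L₁
(one binary and one unary relation symbol) such that for every α with 0 < α < 1/2 − δ,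
the probability that G(n, n^{−α}) EMSO-satisfies φ does not converge as n → ∞. -/
theorem stmt0 (δ : ℝ) (hδ : 0 < δ) :
    ∃ φ : (Lang 1).Sentence,
      ∀ α : ℝ, 0 < α → α < 1 / 2 - δ →
        ¬ ∃ l : ℝ,
            Tendsto (fun n : ℕ => prob n ((n : ℝ) ^ (-α)) (fun G => EMSOSat G φ))
              atTop (nhds l) := by
  obtain ⟨φ, hφ⟩ := exists_sentence_encodes
  refine ⟨φ, fun α h0 h1 => ?_⟩
  rintro ⟨l, hl⟩
  simp only [hφ] at hl
  have hge : 3 / 4 ≤ l := ge_of_tendsto_of_frequently hl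
    (frequently_atTop.2 (exists_le_prob_exists_encodes h0 (by linarith)))
  have hle : l ≤ 1 / 4 := le_of_tendsto_of_frequently hl
    (frequently_atTop.2 (exists_prob_exists_encodes_le h0))
  linarith
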